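/- Let E(L_n) denote the average, over all reduced words i₁⋯i_ℓ for the longest element w₀ ∈ S_n chosen uniformly at random, of the number of positions k ∈ {1,…,ℓ−2} supporting a long braid move. Then lim_{n→∞} n² · E(L_n)/(n(n−1)/2) = 2. -/

import Mathlib

open scoped Classical


/-- The adjacent transposition `sᵢ ∈ S_n` swapping `i` and `i+1` (one-based),
for `i ∈ {1, …, n-1}`; junk value `1` otherwise. -/
def simpleRefl (n i : ℕ) : Equiv.Perm (Fin n) :=
  if h : 1 ≤ i ∧ i < n then Equiv.swap ⟨i - 1, by omega⟩ ⟨i, h.2⟩ else 1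

/-- The product `s_{i₁} ⋯ s_{i_m}` of the word `i₁ ⋯ i_m`. -/
def wordProd (n : ℕ) (l : List ℕ) : Equiv.Perm (Fin n) :=
  (l.map (simpleRefl n)).prod

/-- `l` is a word for `w`: letters in `{1, …, n-1}` and product `w`. -/
def IsWordFor (n : ℕ) (w : Equiv.Perm (Fin n)) (l : List ℕ) : Prop :=
  (∀ i ∈ l, 1 ≤ i ∧ i ≤ n - 1) ∧ wordProd n l = w

/-- `l` is a reduced word for `w`: a word for `w` of minimal length. -/
def IsReducedWordFor (n : ℕ) (w : Equiv.Perm (Fin n)) (l : List ℕ) : Prop :=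
  IsWordFor n w l ∧ ∀ l', IsWordFor n w l' → l.length ≤ l'.length

/-- The longest element `w₀ ∈ S_n`, `w₀(i) = n + 1 - i` in one-line notation. -/
def w₀ (n : ℕ) : Equiv.Perm (Fin n) := Fin.revPerm

/-- The number of positions of the word `l` supporting a commutation,
i.e. positions `k` with `|i_k - i_{k+1}| > 1`. -/
def commCount (l : List ℕ) : ℕ :=
  ((Finset.range (l.length - 1)).filter
    (fun k => 1 < |(l.getD k 0 : ℤ) - (l.getD (k+1) 0 : ℤ)|)).card

/-- The number of consecutive noncommuting pairs in the word `l`,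
i.e. positions `k` with `|i_k - i_{k+1}| = 1`. -/
def noncommCount (l : List ℕ) : ℕ :=
  ((Finset.range (l.length - 1)).filter
    (fun k => |(l.getD k 0 : ℤ) - (l.getD (k+1) 0 : ℤ)| = 1)).card

/-- The number of positions of `l` supporting a long braid move, i.e. positions `k`
with `(i_k, i_{k+1}, i_{k+2})` of the form `(i, i+1, i)` or `(i+1, i, i+1)`. -/
noncomputable def braidCount (l : List ℕ) : ℕ :=
  ((Finset.range (l.length - 2)).filter
    (fun k => ∃ i : ℕ,
      (l.getD k 0, l.getD (k+1) 0, l.getD (k+2) 0) = (i, i+1, i) ∨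
      (l.getD k 0, l.getD (k+1) 0, l.getD (k+2) 0) = (i+1, i, i+1))).card


/-- The average of the statistic `f` over all reduced words for `w₀ ∈ S_n`. -/
noncomputable def expectedStat (n : ℕ) (f : List ℕ → ℕ) : ℝ :=
  (∑ᶠ l ∈ {l : List ℕ | IsReducedWordFor n (w₀ n) l}, (f l : ℝ)) /
    (Nat.card {l : List ℕ // IsReducedWordFor n (w₀ n) l} : ℝ)


/-- Scaling the entries of one row at a time by `a m - d j` acts on the determinant as the
scalar `∑ a - ∑ d`. -/
theorem sum_det_updateRow_sub_mul {ι : Type*} [Fintype ι] [DecidableEq ι] (M : Matrix ι ι ℚ)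
    (a d : ι → ℚ) :
    ∑ m, (M.updateRow m fun j => (a m - d j) * M m j).det = (∑ m, a m - ∑ j, d j) * M.det := by
  simp only [Matrix.det_apply, Finset.mul_sum]
  rw [Finset.sum_comm]
  refine Finset.sum_congr rfl fun σ _ => ?_
  have key : ∀ m, ∏ i, (M.updateRow m fun j => (a m - d j) * M m j) (σ i) i
      = (a m - d (σ.symm m)) * ∏ i, M (σ i) i := by
    intro m
    rw [← Finset.mul_prod_erase _ _ (Finset.mem_univ (σ.symm m)),
      ← Finset.mul_prod_erase (a := σ.symm m) _ (fun i => M (σ i) i) (Finset.mem_univ _)]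
    rw [Finset.prod_congr rfl (g := fun i => M (σ i) i)]
    · simp [mul_assoc]
    · intro i hi
      have : σ i ≠ m := by
        rintro rfl
        simp at hi
      simp [Matrix.updateRow_ne this]
  simp only [key, ← Finset.smul_sum, ← Finset.sum_mul, Finset.sum_sub_distrib,
    Equiv.sum_comp σ.symm d]
  rw [mul_smul_comm]

/-- The Frobenius determinant `det ((x i)_j) / ∏ (x i)!`, where `(x)_j` is the falling factorial.
For `x i = λ_{n-i} + i` it is the number of standard tableaux of shape `λ`, divided by `|λ|!`. -/
noncomputable def frobeniusDet {n : ℕ} (x : Fin n → ℕ) : ℚ :=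
  (Matrix.of fun i j : Fin n => ((x i).descFactorial j : ℚ)).det / ∏ i, ((x i).factorial : ℚ)

theorem frobeniusDet_eq_zero_of_eq {n : ℕ} (x : Fin n → ℕ) {i j : Fin n} (hij : i ≠ j)
    (h : x i = x j) : frobeniusDet x = 0 := by
  rw [frobeniusDet, Matrix.det_zero_of_row_eq hij, zero_div]
  ext k
  simp [h]

theorem sum_frobeniusDet_pred {n : ℕ} (x : Fin n → ℕ) :
    ∑ m, (if 0 < x m then frobeniusDet (Function.update x m (x m - 1)) else 0)
      = (∑ m, (x m : ℚ) - ∑ j : Fin n, (j : ℚ)) * frobeniusDet x := by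
  rw [frobeniusDet, ← mul_div_assoc, ← sum_det_updateRow_sub_mul, Finset.sum_div]
  refine Finset.sum_congr rfl fun m _ => ?_
  split_ifs with h
  · obtain ⟨y, hy⟩ : ∃ y, x m = y + 1 := ⟨x m - 1, by omega⟩
    have hprod : ∏ i, ((x i).factorial : ℚ)
        = (y + 1) * ∏ i, ((Function.update x m (x m - 1) i).factorial : ℚ) := by
      rw [← Finset.mul_prod_erase _ _ (Finset.mem_univ m),
        ← Finset.mul_prod_erase (a := m) _
          (fun i => ((Function.update x m (x m - 1) i).factorial : ℚ)) (Finset.mem_univ _)]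
      rw [← mul_assoc]
      congr 1
      · simp [hy, Nat.factorial_succ]
      · refine Finset.prod_congr rfl fun i hi => ?_
        rw [Function.update_of_ne (Finset.ne_of_mem_erase hi)]
    have hrow : (fun j : Fin n => ((x m : ℚ) - (j : ℚ)) *
          (Matrix.of fun i j : Fin n => ((x i).descFactorial j : ℚ)) m j)
        = ((y : ℚ) + 1) • fun j : Fin n => (y.descFactorial j : ℚ) := by
      ext j
      have h1 := Nat.succ_descFactorial_succ y j
      have h2 := Nat.descFactorial_succ (y + 1) j
      simp only [Matrix.of_apply, hy, Pi.smul_apply, smul_eq_mul]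
      have h3 : ((y + 1 : ℕ) : ℚ) * y.descFactorial j
          = (((y + 1 : ℕ) : ℚ) - j) * (y + 1).descFactorial j := by
        rcases le_or_gt (j : ℕ) (y + 1) with hj | hj
        · rw [← Nat.cast_sub hj]
          exact_mod_cast h1.symm.trans h2
        · rw [Nat.descFactorial_of_lt hj, Nat.descFactorial_of_lt (by omega)]
          simp
      push_cast at h3 ⊢
      exact h3.symm
    have hmat : (Matrix.of fun i j : Fin n =>
          ((Function.update x m (x m - 1) i).descFactorial j : ℚ))
        = (Matrix.of fun i j : Fin n => ((x i).descFactorial j : ℚ)).updateRow m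
            fun j : Fin n => (y.descFactorial j : ℚ) := by
      ext i j
      by_cases hi : i = m
      · subst hi; simp [hy]
      · simp [Function.update_of_ne hi, Matrix.updateRow_ne hi]
    rw [hrow, Matrix.det_updateRow_smul, frobeniusDet, hmat, hprod,
      mul_div_mul_left _ _ (by positivity)]
  · have h0 : x m = 0 := by omega
    have : (fun j : Fin n => ((x m : ℚ) - (j : ℚ)) *
          (Matrix.of fun i j : Fin n => ((x i).descFactorial j : ℚ)) m j) = 0 := by
      ext j
      rcases Nat.eq_zero_or_pos (j : ℕ) with hj | hj
      · simp [h0, hj]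
      · simp [h0, Nat.descFactorial_of_lt hj]
    rw [this, Matrix.det_eq_zero_of_row_eq_zero m (by simp), zero_div]

theorem frobeniusDet_val (n : ℕ) : frobeniusDet (fun i : Fin n => (i : ℕ)) = 1 := by
  rw [frobeniusDet, Matrix.det_of_isLowerTriangular]
  · simp only [Matrix.of_apply, Nat.descFactorial_self]
    exact div_self (Finset.prod_ne_zero_iff.2 fun i _ => by positivity)
  · intro i j hij
    simp only [OrderDual.toDual_lt_toDual] at hij
    simp [Nat.descFactorial_of_lt hij]

theorem frobeniusDet_eq_vandermonde {n : ℕ} (x : Fin n → ℕ) :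
    frobeniusDet x
      = (Matrix.vandermonde fun i => (x i : ℚ)).det / ∏ i, ((x i).factorial : ℚ) := by
  rw [frobeniusDet, Matrix.det_eval_matrixOfPolynomials_eq_det_vandermonde
    (fun i => (x i : ℚ)) (fun j => descPochhammer ℚ j)]
  · congr 2
    ext i j
    simp [descPochhammer_eval_eq_descFactorial]
  · intro i; exact descPochhammer_natDegree ℚ i
  · intro i; exact monic_descPochhammer ℚ i

theorem det_vandermonde_update {n : ℕ} (v : Fin n → ℚ) (b : Fin n) (z : ℚ) :
    (Matrix.vandermonde (Function.update v b z)).det * ∏ j ∈ Finset.univ.erase b, (v b - v j)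
      = (Matrix.vandermonde v).det * ∏ j ∈ Finset.univ.erase b, (z - v j) := by
  have split : ∀ u : Fin n → ℚ, (Matrix.vandermonde u).det
      = (∏ j ∈ Finset.univ.erase b, (u b - u j)) *
        ((∏ j ∈ Finset.univ.erase b, if b < j then (-1 : ℚ) else 1) *
          ∏ i ∈ Finset.univ.erase b, ∏ j ∈ (Finset.Ioi i).erase b, (u j - u i)) := by
    intro u
    rw [Matrix.det_vandermonde, ← Finset.mul_prod_erase _ _ (Finset.mem_univ b)]
    have h1 : ∏ j ∈ Finset.Ioi b, (u j - u b)
        = ∏ j ∈ Finset.univ.erase b, if b < j then u j - u b else 1 := by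
      rw [← Finset.prod_filter]
      refine Finset.prod_congr ?_ fun _ _ => rfl
      ext j
      simp only [Finset.mem_Ioi, Finset.mem_filter, Finset.mem_erase, Finset.mem_univ, and_true]
      exact ⟨fun h => ⟨h.ne', h⟩, fun h => h.2⟩
    rw [h1, ← mul_assoc, ← Finset.prod_mul_distrib, ← Finset.prod_mul_distrib,
      ← Finset.prod_mul_distrib]
    refine Finset.prod_congr rfl fun j hj => ?_
    have hne : j ≠ b := Finset.ne_of_mem_erase hj
    rcases lt_or_gt_of_ne hne with h | h
    · rw [← Finset.mul_prod_erase (Finset.Ioi j) _ (Finset.mem_Ioi.2 h)]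
      simp [not_lt.2 h.le]
    · rw [Finset.erase_eq_of_notMem (s := Finset.Ioi j) (by simp [h.le])]
      simp [h]
  rw [split v, split (Function.update v b z)]
  have e1 : ∏ j ∈ Finset.univ.erase b, (Function.update v b z b - Function.update v b z j)
      = ∏ j ∈ Finset.univ.erase b, (z - v j) :=
    Finset.prod_congr rfl fun j hj => by
      rw [Function.update_self, Function.update_of_ne (Finset.ne_of_mem_erase hj)]
  have e2 : ∏ i ∈ Finset.univ.erase b, ∏ j ∈ (Finset.Ioi i).erase b,
        (Function.update v b z j - Function.update v b z i)
      = ∏ i ∈ Finset.univ.erase b, ∏ j ∈ (Finset.Ioi i).erase b, (v j - v i) :=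
    Finset.prod_congr rfl fun i hi => Finset.prod_congr rfl fun j hj => by
      rw [Function.update_of_ne (Finset.ne_of_mem_erase hj),
        Function.update_of_ne (Finset.ne_of_mem_erase hi)]
  rw [e1, e2]
  ring

theorem frobeniusDet_comp_swap {n : ℕ} (x : Fin n → ℕ) {i j : Fin n} (hij : i ≠ j) :
    frobeniusDet (x ∘ Equiv.swap i j) = - frobeniusDet x := by
  have h := Matrix.det_permute (Equiv.swap i j)
    (Matrix.of fun i j : Fin n => ((x i).descFactorial j : ℚ))
  rw [Equiv.Perm.sign_swap hij] at h
  have hp : ∏ k, (((x ∘ Equiv.swap i j) k).factorial : ℚ) = ∏ k, ((x k).factorial : ℚ) :=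
    Equiv.prod_comp (Equiv.swap i j) fun k => ((x k).factorial : ℚ)
  rw [frobeniusDet, frobeniusDet, hp, ← neg_div]
  congr 1
  simpa [Matrix.submatrix] using h

/-- The coefficients of `(1 - X) ^ (-5/2)`. -/
noncomputable def fiveHalvesCoeff (k : ℕ) : ℚ :=
  ∏ d ∈ Finset.range k, ((2 * d + 5) / (2 * d + 2) : ℚ)

theorem fiveHalvesCoeff_succ (k : ℕ) :
    ((k : ℚ) + 1) * fiveHalvesCoeff (k + 1) = (k + 5 / 2) * fiveHalvesCoeff k := by
  have : (k : ℚ) + 1 ≠ 0 := by positivity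
  rw [fiveHalvesCoeff, fiveHalvesCoeff, Finset.prod_range_succ]
  field_simp

theorem sum_fiveHalvesCoeff_mul (N : ℕ) :
    ∑ p ∈ Finset.HasAntidiagonal.antidiagonal N, fiveHalvesCoeff p.1 * fiveHalvesCoeff p.2
      = (N + 1) * (N + 2) * (N + 3) * (N + 4) / 24 := by
  induction N with
  | zero => norm_num [fiveHalvesCoeff]
  | succ N ih =>
    have hl : ∑ p ∈ Finset.HasAntidiagonal.antidiagonal (N + 1),
        (p.1 : ℚ) * (fiveHalvesCoeff p.1 * fiveHalvesCoeff p.2)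
        = ∑ p ∈ Finset.HasAntidiagonal.antidiagonal N,
          ((p.1 : ℚ) + 5 / 2) * (fiveHalvesCoeff p.1 * fiveHalvesCoeff p.2) := by
      rw [Finset.Nat.sum_antidiagonal_succ]
      simp only [Nat.cast_zero, zero_mul, zero_add]
      refine Finset.sum_congr rfl fun p _ => ?_
      push_cast
      rw [← mul_assoc, fiveHalvesCoeff_succ, mul_assoc]
    have hr : ∑ p ∈ Finset.HasAntidiagonal.antidiagonal (N + 1),
        (p.2 : ℚ) * (fiveHalvesCoeff p.1 * fiveHalvesCoeff p.2)
        = ∑ p ∈ Finset.HasAntidiagonal.antidiagonal N,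
          ((p.2 : ℚ) + 5 / 2) * (fiveHalvesCoeff p.1 * fiveHalvesCoeff p.2) := by
      rw [Finset.Nat.sum_antidiagonal_succ']
      simp only [Nat.cast_zero, zero_mul, zero_add]
      refine Finset.sum_congr rfl fun p _ => ?_
      push_cast
      rw [mul_left_comm, fiveHalvesCoeff_succ]
      ring
    have hsum : ((N : ℚ) + 1) * ∑ p ∈ Finset.HasAntidiagonal.antidiagonal (N + 1),
          fiveHalvesCoeff p.1 * fiveHalvesCoeff p.2
        = (N + 5) * ∑ p ∈ Finset.HasAntidiagonal.antidiagonal N,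
          fiveHalvesCoeff p.1 * fiveHalvesCoeff p.2 := by
      have h := congrArg₂ (· + ·) hl hr
      simp only [← Finset.sum_add_distrib, ← add_mul] at h
      rw [Finset.mul_sum, Finset.mul_sum]
      calc _ = _ := Finset.sum_congr rfl fun p hp => by
            rw [show ((N : ℚ) + 1) = p.1 + p.2 by
              exact_mod_cast (Finset.HasAntidiagonal.mem_antidiagonal.1 hp).symm]
        _ = _ := h
        _ = _ := Finset.sum_congr rfl fun p hp => by
            rw [show (N : ℚ) = p.1 + p.2 by
              exact_mod_cast (Finset.HasAntidiagonal.mem_antidiagonal.1 hp).symm]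
            ring
    rw [ih] at hsum
    have hN : ((N : ℚ) + 1) ≠ 0 := by positivity
    apply mul_left_cancel₀ hN
    rw [hsum]
    push_cast
    ring

/-- The shifted parts of the staircase with the three cells around the inner corner between the
rows `m` and `m + 2` (counted from below) removed. -/
def notchedStaircase (n m : ℕ) (i : Fin n) : ℕ :=
  if (i : ℕ) = m + 1 then 2 * m + 1 else if (i : ℕ) = m + 2 then 2 * m + 2 else 2 * i

theorem prod_two_mul_sub (m : ℕ) :
    (2 * m + 4) * (2 * m + 3) * (2 * m + 2) *
      ∏ d ∈ Finset.range (m + 2), ((2 * d - 1) / (2 * d + 2) : ℚ) = -3 * fiveHalvesCoeff m := by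
  induction m with
  | zero => norm_num [fiveHalvesCoeff, Finset.prod_range_succ]
  | succ m ih =>
    have h1 := fiveHalvesCoeff_succ m
    have h2 : (m : ℚ) + 1 ≠ 0 := by positivity
    have h3 : (m : ℚ) + 3 ≠ 0 := by positivity
    rw [Finset.prod_range_succ]
    apply mul_left_cancel₀ h2
    rw [mul_left_comm _ (-3 : ℚ), h1, mul_left_comm (-3 : ℚ), ← ih]
    have h4 : 2 * ((m : ℚ) + 2) + 2 ≠ 0 := by positivity
    push_cast
    field_simp
    ring

theorem frobeniusDet_notchedStaircase (m e : ℕ) :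
    frobeniusDet (notchedStaircase (m + e + 3) m)
      = 3 * fiveHalvesCoeff m * fiveHalvesCoeff e *
        frobeniusDet (fun i : Fin (m + e + 3) => 2 * (i : ℕ)) := by
  set n := m + e + 3 with hn
  set x : Fin n → ℕ := fun i => 2 * (i : ℕ) with hx
  let a : Fin n := ⟨m + 1, by omega⟩
  let b : Fin n := ⟨m + 2, by omega⟩
  have hab : a ≠ b := by simp [a, b, Fin.ext_iff]
  have hz : notchedStaircase n m = Function.update x b (2 * m + 1) ∘ Equiv.swap a b := by
    ext i
    simp only [Function.comp_apply, notchedStaircase]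
    by_cases h1 : i = a
    · subst h1; simp [a, x, b]
    by_cases h2 : i = b
    · subst h2; simp [hx, a, b]; ring
    · rw [Equiv.swap_apply_of_ne_of_ne h1 h2, Function.update_of_ne h2]
      have h1' : (i : ℕ) ≠ m + 1 := fun h => h1 (Fin.ext h)
      have h2' : (i : ℕ) ≠ m + 2 := fun h => h2 (Fin.ext h)
      simp [h1', h2', hx]
  rw [hz, frobeniusDet_comp_swap _ hab, frobeniusDet_eq_vandermonde, frobeniusDet_eq_vandermonde]
  have hcast : (fun i => ((Function.update x b (2 * m + 1) i : ℕ) : ℚ))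
      = Function.update (fun i => (x i : ℚ)) b (2 * m + 1) := by
    ext i
    by_cases h : i = b
    · subst h; simp
    · simp [Function.update_of_ne h]
  have hfact : ∏ i, ((x i).factorial : ℚ) = ((2 * m + 4) * (2 * m + 3) * (2 * m + 2)) *
      ∏ i, ((Function.update x b (2 * m + 1) i).factorial : ℚ) := by
    rw [← Finset.mul_prod_erase _ _ (Finset.mem_univ b),
      ← Finset.mul_prod_erase (a := b) _
        (fun i => ((Function.update x b (2 * m + 1) i).factorial : ℚ)) (Finset.mem_univ _),
      ← mul_assoc]
    congr 1
    · rw [Function.update_self]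
      have : x b = 2 * m + 1 + 1 + 1 + 1 := by simp [hx, b]; ring
      rw [this]
      simp only [Nat.factorial_succ]
      push_cast
      ring
    · refine Finset.prod_congr rfl fun i hi => ?_
      rw [Function.update_of_ne (Finset.ne_of_mem_erase hi)]
  have hupd := det_vandermonde_update (fun i => (x i : ℚ)) b (2 * m + 1)
  have hne : ∏ j ∈ Finset.univ.erase b, ((x b : ℚ) - x j) ≠ 0 := by
    refine Finset.prod_ne_zero_iff.2 fun j hj => ?_
    have h := Finset.ne_of_mem_erase hj
    rw [sub_ne_zero]
    simp only [hx]
    norm_cast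
    intro h'
    exact h (Fin.ext (by omega))
  have hratio : (∏ j ∈ Finset.univ.erase b, ((2 * m + 1 : ℚ) - x j))
      / ∏ j ∈ Finset.univ.erase b, ((x b : ℚ) - x j)
      = (∏ d ∈ Finset.range (m + 2), ((2 * d - 1) / (2 * d + 2) : ℚ)) * fiveHalvesCoeff e := by
    rw [← Finset.prod_div_distrib]
    let f : ℕ → ℚ := fun j => if j = m + 2 then 1 else
      (2 * m + 1 - (2 * j : ℕ)) / ((2 * (m + 2) : ℕ) - (2 * j : ℕ))
    have h1 : ∏ j ∈ Finset.univ.erase b, ((2 * m + 1 : ℚ) - x j) / ((x b : ℚ) - x j)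
        = ∏ j : Fin n, f j := by
      rw [← Finset.mul_prod_erase Finset.univ _ (Finset.mem_univ b)]
      have : f b = 1 := by simp [f, b]
      rw [this, one_mul]
      refine Finset.prod_congr rfl fun j hj => ?_
      have h := Finset.ne_of_mem_erase hj
      have h' : (j : ℕ) ≠ m + 2 := fun h' => h (Fin.ext h')
      simp only [f, if_neg h', hx, b]
    rw [h1, Fin.prod_univ_eq_prod_range f n, show n = (m + 2 + 1) + e by omega,
      Finset.prod_range_add, Finset.prod_range_succ, ← Finset.prod_range_reflect]
    congr 1
    · have : f (m + 2) = 1 := by simp [f]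
      rw [this, mul_one]
      refine Finset.prod_congr rfl fun d hd => ?_
      have hd' := Finset.mem_range.1 hd
      obtain ⟨q, hq⟩ : ∃ q, m + 2 = d + 1 + q := ⟨m + 2 - (d + 1), by omega⟩
      have h2 : m + 2 - 1 - d = q := by omega
      have hm : (m : ℚ) = d + q - 1 := by
        have : ((m + 2 : ℕ) : ℚ) = ((d + 1 + q : ℕ) : ℚ) := by rw [hq]
        push_cast at this
        linarith
      simp only [f, h2]
      rw [if_neg (by omega)]
      push_cast
      rw [hm]
      congr 1 <;> ring
    · rw [fiveHalvesCoeff]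
      refine Finset.prod_congr rfl fun d _ => ?_
      simp only [f]
      rw [if_neg (by omega)]
      push_cast
      rw [← neg_div_neg_eq]
      congr 1 <;> ring
  rw [div_eq_iff hne] at hratio
  have hV : (Matrix.vandermonde (Function.update (fun i => (x i : ℚ)) b (2 * m + 1))).det
      = (Matrix.vandermonde fun i => (x i : ℚ)).det *
        ((∏ d ∈ Finset.range (m + 2), ((2 * d - 1) / (2 * d + 2) : ℚ)) * fiveHalvesCoeff e) := by
    apply mul_right_cancel₀ hne
    rw [hupd, hratio]
    ring
  have hpos : ∏ i, ((Function.update x b (2 * m + 1) i).factorial : ℚ) ≠ 0 :=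
    Finset.prod_ne_zero_iff.2 fun i _ => by positivity
  have h3 := prod_two_mul_sub m
  have hc : ((2 * m + 4) * (2 * m + 3) * (2 * m + 2) : ℚ) ≠ 0 := by positivity
  rw [hcast, hV, hfact]
  rw [show (3 : ℚ) * fiveHalvesCoeff m = -((2 * m + 4) * (2 * m + 3) * (2 * m + 2) *
      ∏ d ∈ Finset.range (m + 2), ((2 * d - 1) / (2 * d + 2) : ℚ)) by rw [h3]; ring]
  field_simp

theorem sum_frobeniusDet_notchedStaircase (N : ℕ) :
    ∑ m ∈ Finset.range (N + 1), frobeniusDet (notchedStaircase (N + 3) m)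
      = (N + 1) * (N + 2) * (N + 3) * (N + 4) / 8 *
        frobeniusDet (fun i : Fin (N + 3) => 2 * (i : ℕ)) := by
  have h := sum_fiveHalvesCoeff_mul N
  rw [Finset.Nat.sum_antidiagonal_eq_sum_range_succ
    (fun i j => fiveHalvesCoeff i * fiveHalvesCoeff j)] at h
  have : ∀ m ∈ Finset.range (N + 1), frobeniusDet (notchedStaircase (N + 3) m)
      = fiveHalvesCoeff m * fiveHalvesCoeff (N - m) *
        (3 * frobeniusDet (fun i : Fin (N + 3) => 2 * (i : ℕ))) := by
    intro m hm
    obtain ⟨e, rfl⟩ : ∃ e, N = m + e := ⟨N - m, by have := Finset.mem_range.1 hm; omega⟩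
    rw [frobeniusDet_notchedStaircase, Nat.add_sub_cancel_left]
    ring
  rw [Finset.sum_congr rfl this, ← Finset.sum_mul, h]
  ring

theorem frobeniusDet_two_mul_ne_zero (n : ℕ) :
    frobeniusDet (fun i : Fin n => 2 * (i : ℕ)) ≠ 0 := by
  rw [frobeniusDet_eq_vandermonde]
  refine div_ne_zero (Matrix.det_vandermonde_ne_zero_iff.2 fun i j h => ?_)
    (Finset.prod_ne_zero_iff.2 fun i _ => by positivity)
  have : (2 * (i : ℕ) : ℕ) = 2 * (j : ℕ) := by exact_mod_cast h
  exact Fin.ext (by omega)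

/-- The adjacent transposition of `ℤ` exchanging `j` and `j + 1`. -/
def adjSwap (j : ℤ) : Equiv.Perm ℤ := Equiv.swap j (j + 1)

/-- `w` moves only elements of `{0, …, n - 1}`. -/
def FixesOutside (n : ℕ) (w : Equiv.Perm ℤ) : Prop := ∀ x : ℤ, x < 0 ∨ (n : ℤ) ≤ x → w x = x

/-- `j` is a left descent of `w`. -/
def LeftDescent (w : Equiv.Perm ℤ) (j : ℤ) : Prop := w⁻¹ (j + 1) < w⁻¹ j

/-- `b` is a right descent of `w`. -/
def RightDescent (w : Equiv.Perm ℤ) (b : ℤ) : Prop := w (b + 1) < w b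

/-- The number of ways to reach the identity from `w` in `k` steps, each step removing a
left descent. -/
noncomputable def redCount (n : ℕ) : ℕ → Equiv.Perm ℤ → ℚ
  | 0, w => if w = 1 then 1 else 0
  | k + 1, w => ∑ j ∈ Finset.Ico (-1 : ℤ) n,
      if LeftDescent w j then redCount n k (adjSwap j * w) else 0

theorem adjSwap_mul_self (j : ℤ) : adjSwap j * adjSwap j = 1 := Equiv.swap_mul_self _ _

theorem adjSwap_mul_cancel_left (j : ℤ) (w : Equiv.Perm ℤ) : adjSwap j * (adjSwap j * w) = w := by
  rw [← mul_assoc, adjSwap_mul_self, one_mul]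

theorem adjSwap_apply (j x : ℤ) :
    adjSwap j x = if x = j then j + 1 else if x = j + 1 then j else x := by
  rw [adjSwap, Equiv.swap_apply_def]

theorem leftDescent_iff (w : Equiv.Perm ℤ) (j p q : ℤ) (hp : w p = j) (hq : w q = j + 1) :
    LeftDescent w j ↔ q < p := by
  rw [LeftDescent, ← hp, Equiv.Perm.inv_def, Equiv.symm_apply_apply, hp, ← hq,
    Equiv.symm_apply_apply]

theorem FixesOutside.bounds {n : ℕ} {w : Equiv.Perm ℤ} (hw : FixesOutside n w) {x : ℤ}
    (h0 : 0 ≤ x) (hn : x < n) : 0 ≤ w x ∧ w x < n := by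
  constructor
  · by_contra h
    have := w.injective (hw (w x) (Or.inl (by omega)))
    omega
  · by_contra h
    have := w.injective (hw (w x) (Or.inr (by omega)))
    omega

theorem FixesOutside.inv {n : ℕ} {w : Equiv.Perm ℤ} (hw : FixesOutside n w) :
    FixesOutside n w⁻¹ := fun x hx => by
  rw [Equiv.Perm.inv_eq_iff_eq, hw x hx]

theorem FixesOutside.mul {n : ℕ} {v w : Equiv.Perm ℤ} (hv : FixesOutside n v)
    (hw : FixesOutside n w) : FixesOutside n (v * w) := fun x hx => by
  rw [Equiv.Perm.mul_apply, hw x hx, hv x hx]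

theorem fixesOutside_swap {n : ℕ} {a b : ℤ} (ha : 0 ≤ a) (han : a < n) (hb : 0 ≤ b)
    (hbn : b < n) : FixesOutside n (Equiv.swap a b) := fun x hx =>
  Equiv.swap_apply_of_ne_of_ne (by omega) (by omega)

theorem FixesOutside.rightDescent_bounds {n : ℕ} {w : Equiv.Perm ℤ} (hw : FixesOutside n w)
    {b : ℤ} (hb : RightDescent w b) : 0 ≤ b ∧ b + 1 < n := by
  rw [RightDescent] at hb
  constructor
  · by_contra h
    rw [hw b (by omega)] at hb
    have := w.injective (hw (w (b + 1)) (by omega))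
    omega
  · by_contra h
    rw [hw (b + 1) (by omega)] at hb
    have := w.injective (hw (w b) (by omega))
    omega

theorem FixesOutside.leftDescent_bounds {n : ℕ} {w : Equiv.Perm ℤ} (hw : FixesOutside n w)
    {j : ℤ} (hj : LeftDescent w j) : 0 ≤ j ∧ j + 1 < n :=
  hw.inv.rightDescent_bounds hj

theorem FixesOutside.adjSwap_mul {n : ℕ} {w : Equiv.Perm ℤ} (hw : FixesOutside n w)
    {j : ℤ} (hj : 0 ≤ j ∧ j + 1 < n) : FixesOutside n (adjSwap j * w) :=
  (fixesOutside_swap hj.1 (by omega) (by omega) hj.2).mul hw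

theorem leftDescent_and_rightDescent_comm (w : Equiv.Perm ℤ) (j b : ℤ) :
    (LeftDescent w j ∧ RightDescent (adjSwap j * w) b) ↔
      (RightDescent w b ∧ LeftDescent (w * adjSwap b) j) := by
  obtain ⟨p, hp⟩ := w.surjective j
  obtain ⟨q, hq⟩ := w.surjective (j + 1)
  have hb : ∀ x, (adjSwap b) ((adjSwap b) x) = x := fun x => by
    rw [← Equiv.Perm.mul_apply, adjSwap_mul_self, Equiv.Perm.one_apply]
  rw [leftDescent_iff w j p q hp hq, leftDescent_iff (w * adjSwap b) j (adjSwap b p) (adjSwap b q)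
    (by rw [Equiv.Perm.mul_apply, hb, hp]) (by rw [Equiv.Perm.mul_apply, hb, hq])]
  simp only [RightDescent, Equiv.Perm.mul_apply, adjSwap_apply]
  have e : ∀ x y, w x = w y ↔ x = y := fun x y => w.injective.eq_iff
  have e1 := e b p
  have e2 := e b q
  have e3 := e (b + 1) p
  have e4 := e (b + 1) q
  have e5 := e p q
  have e6 := e b (b + 1)
  rw [hp] at e1 e3 e5
  rw [hq] at e2 e4 e5
  split_ifs <;> omega

theorem redCount_succ_right {n : ℕ} (k : ℕ) {w : Equiv.Perm ℤ} (hw : FixesOutside n w) :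
    redCount n (k + 1) w = ∑ b ∈ Finset.Ico (-1 : ℤ) n,
      if RightDescent w b then redCount n k (w * adjSwap b) else 0 := by
  induction k generalizing w with
  | zero =>
    rw [redCount]
    refine Finset.sum_congr rfl fun j _ => ?_
    have h1 : adjSwap j * w = 1 ↔ w = adjSwap j := by
      rw [mul_eq_one_iff_inv_eq, eq_comm, inv_eq_of_mul_eq_one_left (adjSwap_mul_self j)]
    have h2 : w * adjSwap j = 1 ↔ w = adjSwap j := by
      rw [mul_eq_one_iff_eq_inv, inv_eq_of_mul_eq_one_left (adjSwap_mul_self j)]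
    simp only [redCount, h1, h2]
    by_cases h : w = adjSwap j
    · have hl : LeftDescent w j := by
        rw [leftDescent_iff w j (j + 1) j (by simp [h, adjSwap]) (by simp [h, adjSwap])]
        omega
      have hr : RightDescent w j := by
        simp [RightDescent, h, adjSwap]
      simp [hl, hr]
    · simp [h]
  | succ k ih =>
    rw [redCount]
    have hl : ∀ j ∈ Finset.Ico (-1 : ℤ) n,
        (if LeftDescent w j then redCount n (k + 1) (adjSwap j * w) else 0)
        = ∑ b ∈ Finset.Ico (-1 : ℤ) n,
          if LeftDescent w j ∧ RightDescent (adjSwap j * w) b then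
            redCount n k (adjSwap j * (w * adjSwap b)) else 0 := by
      intro j _
      by_cases h : LeftDescent w j
      · rw [if_pos h, ih (hw.adjSwap_mul (hw.leftDescent_bounds h))]
        simp [h, mul_assoc]
      · simp [h]
    have hr : ∀ b ∈ Finset.Ico (-1 : ℤ) n,
        (if RightDescent w b then redCount n (k + 1) (w * adjSwap b) else 0)
        = ∑ j ∈ Finset.Ico (-1 : ℤ) n,
          if LeftDescent w j ∧ RightDescent (adjSwap j * w) b then
            redCount n k (adjSwap j * (w * adjSwap b)) else 0 := by
      intro b _
      by_cases h : RightDescent w b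
      · rw [if_pos h, redCount]
        simp [h, leftDescent_and_rightDescent_comm]
      · simp [h, leftDescent_and_rightDescent_comm]
    rw [Finset.sum_congr rfl hl, Finset.sum_comm, Finset.sum_congr rfl hr]

/-- `w * swap a b` covers `w` in Bruhat order, for `a < b`. -/
def IsCover (w : Equiv.Perm ℤ) (a b : ℤ) : Prop :=
  a < b ∧ w a < w b ∧ ∀ c, a < c → c < b → ¬(w a < w c ∧ w c < w b)

theorem isCover_adjSwap_mul (w : Equiv.Perm ℤ) (a b j : ℤ)
    (h1 : ¬(w a = j ∧ w b = j + 1)) (h2 : ¬(w a = j + 1 ∧ w b = j)) :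
    (IsCover w a b ∧ LeftDescent (w * Equiv.swap a b) j) ↔
      (LeftDescent w j ∧ IsCover (adjSwap j * w) a b) := by
  obtain ⟨p, hp⟩ := w.surjective j
  obtain ⟨q, hq⟩ := w.surjective (j + 1)
  rw [leftDescent_iff w j p q hp hq,
    leftDescent_iff (w * Equiv.swap a b) j (Equiv.swap a b p) (Equiv.swap a b q)
    (by rw [Equiv.Perm.mul_apply, Equiv.swap_apply_self, hp])
    (by rw [Equiv.Perm.mul_apply, Equiv.swap_apply_self, hq])]
  have e : ∀ x y, x ≠ y → w x ≠ w y := fun x y h h' => h (w.injective h')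
  have epq : p ≠ q := by rintro rfl; omega
  obtain ⟨v, hv⟩ : ∃ v, v = adjSwap j * w := ⟨_, rfl⟩
  have hF : ∀ x, (x = p ∧ w x = j ∧ v x = j + 1) ∨ (x = q ∧ w x = j + 1 ∧ v x = j) ∨
      (x ≠ p ∧ x ≠ q ∧ w x ≠ j ∧ w x ≠ j + 1 ∧ v x = w x) := by
    intro x
    have x1 := e x p
    have x2 := e x q
    rw [hv, Equiv.Perm.mul_apply, adjSwap_apply]
    by_cases xp : x = p
    · subst xp
      simp [hp]
    by_cases xq : x = q
    · subst xq
      simp [hq]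
    have x1 := e x p xp
    have x2 := e x q xq
    rw [hp] at x1
    rw [hq] at x2
    simp [xp, xq, x1, x2]
  rw [← hv]
  simp only [IsCover, Equiv.swap_apply_def]
  have Fa := hF a
  have Fb := hF b
  have Fp := hF p
  have Fq := hF q
  constructor
  · rintro ⟨⟨hab, hwab, hc⟩, hd⟩
    have cp := hc p
    have cq := hc q
    have hqp : q < p := by split_ifs at hd <;> omega
    refine ⟨hqp, hab, ?_, ?_⟩
    · omega
    · intro c hac hcb
      have c0 := hc c hac hcb
      have Fc := hF c
      split_ifs at hd <;> omega
  · rintro ⟨hqp, hab, hwab, hc⟩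
    have cp := hc p
    have cq := hc q
    refine ⟨⟨hab, ?_, ?_⟩, ?_⟩
    · omega
    · intro c hac hcb
      have c0 := hc c hac hcb
      have Fc := hF c
      rcases Fa with Fa | Fa | Fa <;> rcases Fb with Fb | Fb | Fb <;> omega
    · rcases Fa with Fa | Fa | Fa <;> rcases Fb with Fb | Fb | Fb <;> split_ifs <;> omega

/-- The sign with which `w * swap r s` occurs in the transition relation at `r`. -/
noncomputable def coverSign (w : Equiv.Perm ℤ) (r s : ℤ) : ℚ :=
  (if IsCover w r s then 1 else 0) - (if IsCover w s r then 1 else 0)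

theorem coverSign_adjSwap_mul (w : Equiv.Perm ℤ) (r s j : ℤ) :
    (if LeftDescent (w * Equiv.swap r s) j then coverSign w r s else 0)
      = (if LeftDescent w j then coverSign (adjSwap j * w) r s else 0)
        + ((if w r = j ∧ w s = j + 1 then 1 else 0) - (if w r = j + 1 ∧ w s = j then 1 else 0)) := by
  have key : ∀ a b : ℤ, w a = j → w b = j + 1 →
      coverSign w a b = (if a < b then 1 else 0) ∧
      coverSign (adjSwap j * w) a b = (if a < b then 0 else -1) ∧
      (LeftDescent (w * Equiv.swap a b) j ↔ a < b) ∧ (LeftDescent w j ↔ b < a) := by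
    intro a b ha hb
    have hab : a ≠ b := by rintro rfl; omega
    have ha' : (adjSwap j * w) a = j + 1 := by simp [adjSwap, ha]
    have hb' : (adjSwap j * w) b = j := by simp [adjSwap, hb]
    refine ⟨?_, ?_, ?_, ?_⟩
    · have c1 : IsCover w a b ↔ a < b :=
        ⟨fun h => h.1, fun h => ⟨h, by omega, fun c _ _ => by omega⟩⟩
      have c2 : ¬ IsCover w b a := fun h => by have := h.2.1; omega
      simp [coverSign, c1, c2]
    · have c1 : IsCover (adjSwap j * w) b a ↔ b < a :=
        ⟨fun h => h.1, fun h => ⟨h, by omega, fun c _ _ => by omega⟩⟩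
      have c2 : ¬ IsCover (adjSwap j * w) a b := fun h => by have := h.2.1; omega
      rw [coverSign, if_neg c2]
      simp only [c1]
      split_ifs <;> first | omega | norm_num
    · exact leftDescent_iff _ j b a (by simp [ha]) (by simp [hb])
    · exact leftDescent_iff _ j a b ha hb
  by_cases h1 : w r = j ∧ w s = j + 1
  · obtain ⟨k1, k2, k3, k4⟩ := key r s h1.1 h1.2
    have hrs : r ≠ s := by rintro rfl; omega
    have h2 : ¬(w r = j + 1 ∧ w s = j) := by omega
    rw [k1, k2, if_pos h1, if_neg h2]
    simp only [k3, k4]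
    split_ifs <;> first | omega | norm_num
  by_cases h2 : w r = j + 1 ∧ w s = j
  · obtain ⟨k1, k2, k3, k4⟩ := key s r h2.2 h2.1
    have hrs : r ≠ s := by rintro rfl; omega
    have flip : ∀ v, coverSign v r s = - coverSign v s r := fun v => by simp [coverSign]
    rw [flip, flip, k1, k2, if_pos h2, if_neg h1, Equiv.swap_comm r s]
    simp only [k3, k4]
    split_ifs <;> first | omega | norm_num
  · have hA := isCover_adjSwap_mul w r s j h1 h2
    have hB := isCover_adjSwap_mul w s r j (by tauto) (by tauto)
    rw [Equiv.swap_comm s r] at hB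
    rw [if_neg h1, if_neg h2]
    simp only [coverSign]
    by_cases d1 : LeftDescent (w * Equiv.swap r s) j <;> by_cases d2 : LeftDescent w j <;>
      simp only [d1, d2, and_true, and_false, true_and, false_and, iff_false, false_iff] at hA hB <;>
      simp [d1, d2, hA, hB]

/-- The transition relation: the reduced word counts of the Bruhat covers `w * swap r s` with
`r < s` and with `s < r` have the same sum. -/
theorem sum_coverSign_mul_redCount {n : ℕ} (k : ℕ) {w : Equiv.Perm ℤ} (hw : FixesOutside n w)
    {r : ℤ} (h0 : 0 ≤ r) (hr : r < n) :
    ∑ s ∈ Finset.Ico (-1 : ℤ) (n + 1),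
      coverSign w r s * redCount n (k + 1) (w * Equiv.swap r s) = 0 := by
  have expand : ∀ s, coverSign w r s * redCount n (k + 1) (w * Equiv.swap r s)
      = ∑ j ∈ Finset.Ico (-1 : ℤ) n,
        ((if LeftDescent w j then coverSign (adjSwap j * w) r s *
            redCount n k (adjSwap j * w * Equiv.swap r s) else 0)
          + ((if w r = j ∧ w s = j + 1 then redCount n k w else 0)
            - (if w r = j + 1 ∧ w s = j then redCount n k w else 0))) := by
    intro s
    rw [redCount, Finset.mul_sum]
    refine Finset.sum_congr rfl fun j _ => ?_
    have h := coverSign_adjSwap_mul w r s j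
    have back : (w r = j ∧ w s = j + 1) ∨ (w r = j + 1 ∧ w s = j) →
        adjSwap j * w * Equiv.swap r s = w := by
      intro h
      have : w * Equiv.swap r s = adjSwap j * w := by
        rw [Equiv.mul_swap_eq_swap_mul, adjSwap]
        rcases h with ⟨h1, h2⟩ | ⟨h1, h2⟩
        · rw [h1, h2]
        · rw [h1, h2, Equiv.swap_comm]
      rw [mul_assoc, this, adjSwap_mul_cancel_left]
    calc _ = (if LeftDescent (w * Equiv.swap r s) j then coverSign w r s else 0)
          * redCount n k (adjSwap j * w * Equiv.swap r s) := by
          rw [← mul_assoc (adjSwap j)]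
          split_ifs <;> simp
      _ = _ := by
          rw [h, add_mul, sub_mul]
          congr 1
          · split_ifs <;> simp
          · congr 1
            · split_ifs with h'
              · rw [back (Or.inl h'), one_mul]
              · simp
            · split_ifs with h'
              · rw [back (Or.inr h'), one_mul]
              · simp
  have main : ∀ j ∈ Finset.Ico (-1 : ℤ) n, LeftDescent w j →
      ∑ s ∈ Finset.Ico (-1 : ℤ) (n + 1), coverSign (adjSwap j * w) r s *
            redCount n k (adjSwap j * w * Equiv.swap r s) = 0 := by
    intro j _ hj
    cases k with
    | zero =>
      refine Finset.sum_eq_zero fun s _ => ?_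
      rw [redCount]
      split_ifs with h
      · have hv : adjSwap j * w = Equiv.swap r s := by
          rw [mul_eq_one_iff_eq_inv.1 h, Equiv.swap_inv]
        rw [hv, coverSign, if_neg, if_neg]
        · simp
        · rintro ⟨h1, h2, -⟩
          simp at h2
          omega
        · rintro ⟨h1, h2, -⟩
          simp at h2
          omega
      · simp
    | succ k =>
      exact sum_coverSign_mul_redCount k (hw.adjSwap_mul (hw.leftDescent_bounds hj)) h0 hr
  simp only [expand]
  rw [Finset.sum_comm]
  simp only [Finset.sum_add_distrib, Finset.sum_sub_distrib]
  have z : ∑ j ∈ Finset.Ico (-1 : ℤ) n, ∑ s ∈ Finset.Ico (-1 : ℤ) (n + 1),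
      (if LeftDescent w j then coverSign (adjSwap j * w) r s *
            redCount n k (adjSwap j * w * Equiv.swap r s) else 0) = 0 := by
    refine Finset.sum_eq_zero fun j hj => ?_
    by_cases h : LeftDescent w j
    · simpa [h] using main j hj h
    · simp [h]
  have hb := hw.bounds h0 hr
  have mem : ∀ y : ℤ, -1 ≤ y → y ≤ n → w⁻¹ y ∈ Finset.Ico (-1 : ℤ) (n + 1) := by
    intro y h1 h2
    rw [Finset.mem_Ico]
    by_cases hy : y < 0 ∨ (n : ℤ) ≤ y
    · rw [hw.inv y hy]
      omega
    · have := hw.inv.bounds (x := y) (by omega) (by omega)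
      omega
  have up : ∑ j ∈ Finset.Ico (-1 : ℤ) n, ∑ s ∈ Finset.Ico (-1 : ℤ) (n + 1),
      (if w r = j ∧ w s = j + 1 then redCount n k w else 0) = redCount n k w := by
    rw [Finset.sum_eq_single (w r), Finset.sum_eq_single (w⁻¹ (w r + 1))]
    · simp
    · intro s _ hs
      rw [if_neg]
      rintro ⟨-, h⟩
      exact hs (by rw [← h, Equiv.Perm.inv_def, Equiv.symm_apply_apply])
    · intro h
      exact absurd (mem _ (by omega) (by omega)) h
    · intro j _ hj
      exact Finset.sum_eq_zero fun s _ => if_neg fun h => hj h.1.symm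
    · intro h
      exact absurd (Finset.mem_Ico.2 ⟨by omega, hb.2⟩) h
  have down : ∑ j ∈ Finset.Ico (-1 : ℤ) n, ∑ s ∈ Finset.Ico (-1 : ℤ) (n + 1),
      (if w r = j + 1 ∧ w s = j then redCount n k w else 0) = redCount n k w := by
    rw [Finset.sum_eq_single (w r - 1), Finset.sum_eq_single (w⁻¹ (w r - 1))]
    · simp
    · intro s _ hs
      rw [if_neg]
      rintro ⟨-, h⟩
      exact hs (by rw [← h, Equiv.Perm.inv_def, Equiv.symm_apply_apply])
    · intro h
      exact absurd (mem _ (by omega) (by omega)) h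
    · intro j _ hj
      exact Finset.sum_eq_zero fun s _ => if_neg fun h => hj (by omega)
    · intro h
      exact absurd (Finset.mem_Ico.2 ⟨by omega, by omega⟩) h
  rw [z, up, down]
  ring

/-- `w` avoids the pattern `132` on `{0, …, n - 1}`. -/
def IsDominant (n : ℕ) (w : Equiv.Perm ℤ) : Prop :=
  ∀ i j m : ℤ, 0 ≤ i → i < j → j < m → m < n → ¬(w i < w m ∧ w m < w j)

/-- The entry at position `a` of the Lehmer code of `w`. -/
noncomputable def lehmer (n : ℕ) (w : Equiv.Perm ℤ) (a : ℤ) : ℕ :=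
  ((Finset.Ioo a (n : ℤ)).filter fun c => w c < w a).card

theorem lehmer_eq_lehmer_succ {n : ℕ} {w : Equiv.Perm ℤ} (hw : IsDominant n w) {b : ℤ}
    (h0 : 0 ≤ b) (hb : ¬ RightDescent w b) : lehmer n w b = lehmer n w (b + 1) := by
  have hne : w b ≠ w (b + 1) := fun h => by have := w.injective h; omega
  rw [RightDescent] at hb
  rw [lehmer, lehmer]
  congr 1
  ext c
  simp only [Finset.mem_filter, Finset.mem_Ioo]
  constructor
  · rintro ⟨⟨h1, h2⟩, h3⟩
    have : c ≠ b + 1 := by rintro rfl; omega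
    omega
  · rintro ⟨⟨h1, h2⟩, h3⟩
    have := hw b (b + 1) c h0 (by omega) h1 h2
    have : w b ≠ w c := fun h => by have := w.injective h; omega
    omega

/-- Among the smaller entries to the right of a right descent there is a largest one. -/
theorem exists_predecessor {n : ℕ} {w : Equiv.Perm ℤ} (hf : FixesOutside n w) {b : ℤ}
    (hb : RightDescent w b) : ∃ s, b < s ∧ s < n ∧ w s < w b ∧
      ∀ c, b < c → c < n → c ≠ s → w c < w b → w c < w s := by
  have hbb := hf.rightDescent_bounds hb
  obtain ⟨s, hs, hmax⟩ := Finset.exists_max_image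
    ((Finset.Ioo b (n : ℤ)).filter fun c => w c < w b) w
    ⟨b + 1, by simp only [Finset.mem_filter, Finset.mem_Ioo]; exact ⟨by omega, hb⟩⟩
  simp only [Finset.mem_filter, Finset.mem_Ioo] at hs hmax
  refine ⟨s, hs.1.1, hs.1.2, hs.2, fun c h1 h2 h3 h4 => ?_⟩
  exact lt_of_le_of_ne (hmax c ⟨⟨h1, h2⟩, h4⟩) fun h => h3 (w.injective h)

section Predecessor

variable {n : ℕ} {w : Equiv.Perm ℤ} {b s : ℤ}

theorem lt_of_lt_predecessor (hd : IsDominant n w) (hbb : 0 ≤ b)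
    (hb : RightDescent w b) (hbs : b < s) (hsn : s < n)
    (hmax : ∀ c, b < c → c < n → c ≠ s → w c < w b → w c < w s) :
    ∀ c, b < c → c < s → w c < w s := by
  intro c h1 h2
  rw [RightDescent] at hb
  have hne : w c ≠ w s := fun h => by have := w.injective h; omega
  have m1 := hmax c h1 (by omega) (by omega)
  by_cases h : c = b + 1
  · subst h
    exact m1 hb
  · have m2 := hmax (b + 1) (by omega) (by omega) (by omega) hb
    have := hd (b + 1) c s (by omega) (by omega) h2 hsn
    omega

theorem mul_swap_apply (w : Equiv.Perm ℤ) (b s x : ℤ) : (w * Equiv.swap b s) x =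
    if x = b then w s else if x = s then w b else w x := by
  rw [Equiv.Perm.mul_apply, Equiv.swap_apply_def]
  split_ifs <;> rfl

theorem isDominant_mul_swap (hd : IsDominant n w) (hbb : 0 ≤ b)
    (hb : RightDescent w b) (hbs : b < s) (hsn : s < n) (hws : w s < w b)
    (hmax : ∀ c, b < c → c < n → c ≠ s → w c < w b → w c < w s) :
    IsDominant n (w * Equiv.swap b s) := by
  have F2 := lt_of_lt_predecessor hd hbb hb hbs hsn hmax
  have e : ∀ x y, x ≠ y → w x ≠ w y := fun x y h h' => h (w.injective h')
  intro i j m hi hij hjm hmn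
  simp only [mul_swap_apply]
  have d1 := hd i j m hi hij hjm hmn
  have d2 := hd b j m hbb
  have d3 := hd i b m hi
  have d4 := hd i s m hi
  have d5 := hd i j s hi hij
  have d6 := hd i j b hi hij
  have f1 := hmax m
  have f2 := F2 j
  have e1 := e m b
  split_ifs <;> omega

theorem lehmer_mul_swap_self (hbs : b < s) (hsn : s < n) (hws : w s < w b)
    (hmax : ∀ c, b < c → c < n → c ≠ s → w c < w b → w c < w s) :
    lehmer n w b = lehmer n (w * Equiv.swap b s) b + 1 := by
  rw [lehmer, lehmer, ← Finset.card_insert_of_notMem (a := s)]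
  · congr 1
    ext c
    simp only [Finset.mem_filter, Finset.mem_Ioo, Finset.mem_insert, mul_swap_apply]
    have m := hmax c
    by_cases h : c = s
    · subst h
      simp [hbs, hsn, hws]
    · split_ifs <;> omega
  · simp only [Finset.mem_filter, Finset.mem_Ioo, mul_swap_apply]
    split_ifs <;> omega

theorem lehmer_mul_swap_of_ne (hd : IsDominant n w) (hbb : 0 ≤ b)
    (hb : RightDescent w b) (hbs : b < s) (hsn : s < n) (hws : w s < w b)
    (hmax : ∀ c, b < c → c < n → c ≠ s → w c < w b → w c < w s) {a : ℤ} (ha : a ≠ b) :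
    lehmer n (w * Equiv.swap b s) a = lehmer n w a := by
  have F2 := lt_of_lt_predecessor hd hbb hb hbs hsn hmax
  rcases lt_or_gt_of_ne ha with ha | ha
  · refine Finset.card_equiv (Equiv.swap b s) fun c => ?_
    simp only [Finset.mem_filter, Finset.mem_Ioo, mul_swap_apply, Equiv.swap_apply_def]
    split_ifs with h1 h2 <;> omega
  · rw [lehmer, lehmer]
    congr 1
    ext c
    simp only [Finset.mem_filter, Finset.mem_Ioo, mul_swap_apply]
    have m := hmax c
    have f := F2 a
    by_cases has : a = s
    · subst has
      split_ifs <;> omega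
    · split_ifs with h1 h2
      · omega
      · subst h2
        omega
      · omega

theorem redCount_mul_adjSwap (hf : FixesOutside n w) (hd : IsDominant n w)
    (hb : RightDescent w b) (hbs : b < s) (hsn : s < n) (hws : w s < w b)
    (hmax : ∀ c, b < c → c < n → c ≠ s → w c < w b → w c < w s) (k : ℕ) :
    redCount n k (w * adjSwap b) = redCount n k (w * Equiv.swap b s) := by
  have hbb := hf.rightDescent_bounds hb
  have F2 := lt_of_lt_predecessor hd hbb.1 hb hbs hsn hmax
  by_cases hs1 : s = b + 1
  · rw [hs1, adjSwap]
  have hb1 := F2 (b + 1) (by omega) (by omega)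
  cases k with
  | zero =>
    rw [redCount, redCount, if_neg, if_neg]
    · intro h
      have h1 := DFunLike.congr_fun h b
      have h2 := DFunLike.congr_fun h (b + 1)
      simp only [mul_swap_apply, Equiv.Perm.one_apply] at h1 h2
      split_ifs at h1 h2 <;> omega
    · intro h
      have h1 := DFunLike.congr_fun h (b + 1)
      have h2 := DFunLike.congr_fun h s
      rw [adjSwap] at h1 h2
      simp only [mul_swap_apply, Equiv.Perm.one_apply] at h1 h2
      split_ifs at h1 h2 <;> omega
  | succ k =>
    obtain ⟨v, hv⟩ : ∃ v, v = w * Equiv.swap b s * adjSwap b := ⟨_, rfl⟩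
    have hvf : FixesOutside n v := by
      rw [hv]
      exact (hf.mul (fixesOutside_swap hbb.1 (by omega) (by omega) hsn)).mul
        (fixesOutside_swap hbb.1 (by omega) (by omega) hbb.2)
    have v_apply : ∀ x, v x = if x = b then w (b + 1) else if x = b + 1 then w s else
        if x = s then w b else w x := by
      intro x
      rw [hv, adjSwap, mul_swap_apply, mul_swap_apply, mul_swap_apply]
      simp only [mul_swap_apply]
      split_ifs <;> first | rfl | omega
    have v1 : v * Equiv.swap (b + 1) s = w * adjSwap b := by
      ext x
      rw [adjSwap, mul_swap_apply, mul_swap_apply, v_apply, v_apply, v_apply]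
      split_ifs <;> first | rfl | omega | (congr 1; omega)
    have v2 : v * Equiv.swap (b + 1) b = w * Equiv.swap b s := by
      rw [hv, mul_assoc, Equiv.swap_comm (b + 1) b, adjSwap, Equiv.swap_mul_self, mul_one]
    have vb : v b = w (b + 1) := by simp [v_apply]
    have vb1 : v (b + 1) = w s := by simp [v_apply]
    have vs : v s = w b := by
      rw [v_apply]
      split_ifs <;> first | rfl | omega
    have vo : ∀ c, c ≠ b → c ≠ b + 1 → c ≠ s → v c = w c := fun c h1 h2 h3 => by
      simp [v_apply, h1, h2, h3]
    have e : ∀ x y, x ≠ y → w x ≠ w y := fun x y h h' => h (w.injective h')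
    have hwb := hf.bounds hbb.1 (by omega)
    have hwb1 := hf.bounds (x := b + 1) (by omega) hbb.2
    have c1 : ∀ c, IsCover v (b + 1) c ↔ c = s := by
      intro c
      constructor
      · rintro ⟨h1, h2, h3⟩
        by_contra hc
        have h4 := vo c (by omega) (by omega) hc
        have h5 := h3 s
        have m := hmax c
        have f := F2 c
        have e1 := e c b
        have g := hf c
        omega
      · rintro rfl
        refine ⟨by omega, by omega, fun c h1 h2 => ?_⟩
        have h4 := vo c (by omega) (by omega) (by omega)
        have f := F2 c
        omega
    have c2 : ∀ c, IsCover v c (b + 1) ↔ c = b := by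
      intro c
      constructor
      · rintro ⟨h1, h2, h3⟩
        by_contra hc
        have h4 := vo c (by omega) (by omega) (by omega)
        have h5 := h3 b
        have e1 := e c (b + 1)
        have g := hf c
        have d := hd c b s
        omega
      · rintro rfl
        exact ⟨by omega, by omega, fun c h1 h2 => by omega⟩
    have h := sum_coverSign_mul_redCount k hvf (r := b + 1) (by omega) hbb.2
    simp only [coverSign, c1, c2, sub_mul, ite_mul, one_mul, zero_mul, Finset.sum_sub_distrib,
      Finset.sum_ite_eq', Finset.mem_Ico] at h
    rw [if_pos (by omega), if_pos (by omega), v1, v2] at h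
    linarith

end Predecessor

theorem eq_one_of_lehmer_eq_zero {n : ℕ} {w : Equiv.Perm ℤ} (hf : FixesOutside n w)
    (h : ∀ a : ℤ, 0 ≤ a → a < n → lehmer n w a = 0) : w = 1 := by
  have step : ∀ a, w a < w (a + 1) := by
    intro a
    by_contra hlt
    have hne : w a ≠ w (a + 1) := fun h => by have := w.injective h; omega
    have hr : RightDescent w a := by rw [RightDescent]; omega
    have hb := hf.rightDescent_bounds hr
    have := h a hb.1 (by omega)
    rw [lehmer, Finset.card_eq_zero] at this
    have hm : a + 1 ∈ (Finset.Ioo a (n : ℤ)).filter fun c => w c < w a := by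
      simp only [Finset.mem_filter, Finset.mem_Ioo]
      exact ⟨by omega, hr⟩
    rw [this] at hm
    simp at hm
  have lo : ∀ d : ℕ, (-1 + d : ℤ) ≤ w (-1 + d) := by
    intro d
    induction d with
    | zero => have := hf (-1) (by omega); simp [this]
    | succ d ih =>
      have := step (-1 + d)
      push_cast
      rw [← add_assoc]
      omega
  have hi : ∀ d : ℕ, w (n - d) ≤ (n - d : ℤ) := by
    intro d
    induction d with
    | zero => have := hf n (by omega); simp [this]
    | succ d ih =>
      have := step (n - (d + 1))
      rw [show (n : ℤ) - (d + 1) + 1 = n - d by ring] at this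
      push_cast
      omega
  ext x
  rw [Equiv.Perm.one_apply]
  by_cases hx : x < 0 ∨ (n : ℤ) ≤ x
  · exact hf x hx
  · have h1 := lo (x + 1).toNat
    have h2 := hi (n - x).toNat
    rw [Int.toNat_of_nonneg (by omega)] at h1 h2
    rw [show (-1 : ℤ) + (x + 1) = x by ring] at h1
    rw [show (n : ℤ) - (n - x) = x by ring] at h2
    omega

theorem lehmer_last (n : ℕ) (w : Equiv.Perm ℤ) : lehmer n w (n - 1) = 0 := by
  rw [lehmer, Finset.card_eq_zero, Finset.filter_eq_empty_iff]
  intro c hc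
  rw [Finset.mem_Ioo] at hc
  omega

theorem sum_Ico_eq_sum_fin {M : Type*} [AddCommMonoid M] (n : ℕ) (f : ℤ → M) :
    ∑ b ∈ Finset.Ico (0 : ℤ) n, f b = ∑ m : Fin n, f (n - 1 - (m : ℕ)) := by
  refine Finset.sum_bij' (fun b hb => (⟨(n - 1 - b).toNat, by
      rw [Finset.mem_Ico] at hb; omega⟩ : Fin n)) (fun m _ => (n - 1 - (m : ℕ) : ℤ)) ?_ ?_ ?_ ?_ ?_
  · simp
  · intro m _
    rw [Finset.mem_Ico]
    have := m.2
    omega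
  · intro b hb
    rw [Finset.mem_Ico] at hb
    simp only
    omega
  · intro m _
    ext
    simp only
    omega
  · intro b hb
    rw [Finset.mem_Ico] at hb
    congr 1
    simp only
    omega

/-- The strictly shifted Lehmer code, read from right to left. -/
noncomputable def shiftedCode (n : ℕ) (w : Equiv.Perm ℤ) (m : Fin n) : ℕ :=
  lehmer n w (n - 1 - (m : ℕ)) + m

/-- The number of inversions of `w`. -/
noncomputable def invCount (n : ℕ) (w : Equiv.Perm ℤ) : ℕ :=
  ∑ b ∈ Finset.Ico (0 : ℤ) n, lehmer n w b

/-- Reduced words of dominant permutations are counted by the Frobenius determinant. -/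
theorem redCount_eq_frobeniusDet {n : ℕ} (k : ℕ) {w : Equiv.Perm ℤ} (hf : FixesOutside n w)
    (hd : IsDominant n w) (hk : invCount n w = k) :
    redCount n k w = (k.factorial : ℚ) * frobeniusDet (shiftedCode n w) := by
  induction k generalizing w with
  | zero =>
    have hz : ∀ a : ℤ, 0 ≤ a → a < n → lehmer n w a = 0 := by
      rw [invCount, Finset.sum_eq_zero_iff] at hk
      intro a h0 h1
      exact hk a (Finset.mem_Ico.2 ⟨h0, h1⟩)
    have hs : shiftedCode n w = fun i : Fin n => (i : ℕ) := by
      funext i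
      rw [shiftedCode, hz _ (by have := i.2; omega) (by omega), zero_add]
    rw [redCount, if_pos (eq_one_of_lehmer_eq_zero hf hz), hs, frobeniusDet_val]
    simp
  | succ k ih =>
    have hsum : (∑ m, (shiftedCode n w m : ℚ)) - ∑ j : Fin n, ((j : ℕ) : ℚ) = (k + 1 : ℕ) := by
      rw [← hk, invCount, sum_Ico_eq_sum_fin]
      simp only [shiftedCode]
      push_cast
      rw [Finset.sum_add_distrib]
      ring
    have hrec := sum_frobeniusDet_pred (shiftedCode n w)
    rw [hsum] at hrec
    rw [redCount_succ_right k hf, ← Finset.sum_subset (s₁ := Finset.Ico (0 : ℤ) n)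
      (Finset.Ico_subset_Ico (by omega) le_rfl), sum_Ico_eq_sum_fin, Nat.factorial_succ,
      Nat.cast_mul, mul_comm ((k + 1 : ℕ) : ℚ), mul_assoc, ← hrec, Finset.mul_sum]
    · refine Finset.sum_congr rfl fun m _ => ?_
      have hm := m.2
      by_cases hb : RightDescent w (n - 1 - (m : ℕ))
      · have hbb := hf.rightDescent_bounds hb
        obtain ⟨s, hbs, hsn, hws, hmax⟩ := exists_predecessor hf hb
        have hself := lehmer_mul_swap_self hbs hsn hws hmax
        have hfs : FixesOutside n (w * Equiv.swap ((n : ℤ) - 1 - (m : ℕ)) s) :=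
          hf.mul (fixesOutside_swap (by omega) (by omega) (by omega) hsn)
        have hother := fun a (ha : a ≠ _) =>
          lehmer_mul_swap_of_ne hd hbb.1 hb hbs hsn hws hmax (a := a) ha
        have hcode : Function.update (shiftedCode n w) m (shiftedCode n w m - 1)
            = shiftedCode n (w * Equiv.swap ((n : ℤ) - 1 - (m : ℕ)) s) := by
          funext i
          by_cases hi : i = m
          · subst hi
            rw [Function.update_self, shiftedCode, shiftedCode]
            omega
          · rw [Function.update_of_ne hi, shiftedCode, shiftedCode, hother]
            intro h
            exact hi (Fin.ext (by omega))
        rw [if_pos hb, if_pos (by rw [shiftedCode]; omega), hcode,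
          redCount_mul_adjSwap hf hd hb hbs hsn hws hmax]
        refine ih hfs (isDominant_mul_swap hd hbb.1 hb hbs hsn hws hmax) ?_
        have hmem : (n - 1 - (m : ℕ) : ℤ) ∈ Finset.Ico (0 : ℤ) n :=
          Finset.mem_Ico.2 ⟨by omega, by omega⟩
        have split := fun v => Finset.add_sum_erase _ (fun a => lehmer n v a) hmem
        rw [invCount, ← split] at hk ⊢
        have herase := Finset.sum_congr rfl fun a (ha : a ∈ (Finset.Ico (0 : ℤ) n).erase
          (n - 1 - (m : ℕ))) => hother a (Finset.ne_of_mem_erase ha)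
        rw [herase]
        change _ + Finset.sum _ (lehmer n w) = _ at hk
        omega
      · rw [if_neg hb]
        symm
        split_ifs with h
        · rcases Nat.eq_zero_or_pos (m : ℕ) with h0 | h0
          · rw [shiftedCode, h0, Nat.cast_zero, sub_zero, lehmer_last] at h
            omega
          · have hl := lehmer_eq_lehmer_succ hd (by omega) hb
            rw [frobeniusDet_eq_zero_of_eq _ (i := m) (j := ⟨m - 1, by omega⟩), mul_zero]
            · intro h'
              have := congrArg Fin.val h'
              simp only at this
              omega
            · rw [Function.update_self, Function.update_of_ne, shiftedCode, shiftedCode, hl]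
              · have : (n - 1 - (m : ℕ) + 1 : ℤ) = n - 1 - ((m - 1 : ℕ) : ℤ) := by omega
                simp only [this]
                omega
              · intro h'
                have := congrArg Fin.val h'
                simp only at this
                omega
        · simp
    · intro b hb hb'
      rw [Finset.mem_Ico] at hb hb'
      rw [if_neg]
      intro h
      have := hf.rightDescent_bounds h
      omega

theorem invCount_adjSwap_mul {n : ℕ} {w : Equiv.Perm ℤ} (hf : FixesOutside n w) {j : ℤ}
    (hj : 0 ≤ j) (hjn : j + 1 < n) (hl : ¬ LeftDescent w j) :
    invCount n (adjSwap j * w) = invCount n w + 1 := by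
  obtain ⟨p, hp⟩ := w.surjective j
  obtain ⟨q, hq⟩ := w.surjective (j + 1)
  have hpq : p ≠ q := by rintro rfl; omega
  rw [leftDescent_iff w j p q hp hq] at hl
  have gp := hf p
  have gq := hf q
  have e : ∀ x y, w x = w y ↔ x = y := fun x y => w.injective.eq_iff
  have ep : ∀ x, w x = j ↔ x = p := fun x => by rw [← hp, e]
  have eq : ∀ x, w x = j + 1 ↔ x = q := fun x => by rw [← hq, e]
  have key : ∀ a, lehmer n (adjSwap j * w) a = lehmer n w a + if a = p then 1 else 0 := by
    intro a
    have a1 := ep a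
    have a2 := eq a
    by_cases ha : a = p
    · subst ha
      rw [if_pos rfl, lehmer, lehmer, ← Finset.card_insert_of_notMem (a := q)]
      · congr 1
        ext c
        have c1 := ep c
        have c2 := eq c
        simp only [Finset.mem_filter, Finset.mem_Ioo, Finset.mem_insert, Equiv.Perm.mul_apply,
          adjSwap_apply, ep, eq]
        split_ifs <;> omega
      · simp only [Finset.mem_filter, Finset.mem_Ioo]
        omega
    · rw [if_neg ha, add_zero, lehmer, lehmer]
      congr 1
      ext c
      have c1 := ep c
      have c2 := eq c
      simp only [Finset.mem_filter, Finset.mem_Ioo, Equiv.Perm.mul_apply, adjSwap_apply, ep, eq]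
      split_ifs <;> omega
  simp only [invCount, key, Finset.sum_add_distrib, Finset.sum_ite_eq', Finset.mem_Ico]
  rw [if_pos (by omega)]

theorem invCount_of_leftDescent {n : ℕ} {w : Equiv.Perm ℤ} (hf : FixesOutside n w) {j : ℤ}
    (hl : LeftDescent w j) : invCount n w = invCount n (adjSwap j * w) + 1 := by
  have hj := hf.leftDescent_bounds hl
  rw [← invCount_adjSwap_mul (hf.adjSwap_mul hj) hj.1 hj.2, adjSwap_mul_cancel_left]
  obtain ⟨p, hp⟩ := w.surjective j
  obtain ⟨q, hq⟩ := w.surjective (j + 1)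
  rw [leftDescent_iff w j p q hp hq] at hl
  rw [leftDescent_iff (adjSwap j * w) j q p (by simp [adjSwap, hq]) (by simp [adjSwap, hp])]
  omega

theorem invCount_one (n : ℕ) : invCount n 1 = 0 := by
  refine Finset.sum_eq_zero fun a _ => ?_
  rw [lehmer, Finset.card_eq_zero, Finset.filter_eq_empty_iff]
  intro c hc
  rw [Finset.mem_Ioo] at hc
  rw [Equiv.Perm.one_apply, Equiv.Perm.one_apply]
  omega

/-- The words of length `k` in the letters `1, …, n - 1` with product `w`. -/
noncomputable def words (n : ℕ) : ℕ → Equiv.Perm ℤ → Finset (List ℕ)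
  | 0, w => if w = 1 then {[]} else ∅
  | k + 1, w => (Finset.Ico 1 n).biUnion fun i =>
      (words n k (adjSwap ((i : ℤ) - 1) * w)).image (List.cons i)

theorem mem_words {n k : ℕ} {w : Equiv.Perm ℤ} {l : List ℕ} : l ∈ words n k w ↔
    l.length = k ∧ (∀ i ∈ l, 1 ≤ i ∧ i < n) ∧
      (l.map fun i : ℕ => adjSwap ((i : ℤ) - 1)).prod = w := by
  induction k generalizing w l with
  | zero =>
    rw [words, List.length_eq_zero_iff]
    split_ifs with h
    · rw [Finset.mem_singleton]
      constructor
      · rintro rfl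
        simp [h]
      · exact fun h => h.1
    · simp only [Finset.notMem_empty, false_iff]
      rintro ⟨rfl, -, h'⟩
      exact h (by simpa using h'.symm)
  | succ k ih =>
    simp only [words, Finset.mem_biUnion, Finset.mem_image, Finset.mem_Ico, ih]
    constructor
    · rintro ⟨i, hi, t, ⟨h1, h2, h3⟩, rfl⟩
      refine ⟨by simp [h1], by simpa using ⟨hi, h2⟩, ?_⟩
      rw [List.map_cons, List.prod_cons, h3, adjSwap_mul_cancel_left]
    · rintro ⟨h1, h2, h3⟩
      cases l with
      | nil => simp at h1
      | cons i t =>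
        rw [List.map_cons, List.prod_cons] at h3
        refine ⟨i, h2 i (by simp), t, ⟨by simpa using h1, fun j hj => h2 j (by simp [hj]), ?_⟩,
          rfl⟩
        rw [← h3, adjSwap_mul_cancel_left]

theorem card_filter_words_succ (n k : ℕ) (w : Equiv.Perm ℤ) (P : List ℕ → Prop) :
    ((words n (k + 1) w).filter P).card = ∑ i ∈ Finset.Ico 1 n,
      ((words n k (adjSwap ((i : ℤ) - 1) * w)).filter fun t => P (i :: t)).card := by
  rw [words, Finset.filter_biUnion, Finset.card_biUnion]
  · refine Finset.sum_congr rfl fun i _ => ?_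
    rw [Finset.filter_image, Finset.card_image_of_injective _ List.cons_injective]
  · intro i _ j _ hij
    rw [Function.onFun, Finset.disjoint_left]
    intro l hl hl'
    simp only [Finset.mem_filter, Finset.mem_image] at hl hl'
    obtain ⟨⟨t, -, rfl⟩, -⟩ := hl
    obtain ⟨⟨t', -, h⟩, -⟩ := hl'
    exact hij (List.cons.inj h).1.symm

theorem card_words_succ (n k : ℕ) (w : Equiv.Perm ℤ) :
    (words n (k + 1) w).card = ∑ i ∈ Finset.Ico 1 n,
      (words n k (adjSwap ((i : ℤ) - 1) * w)).card := by
  have := card_filter_words_succ n k w fun _ => True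
  simpa using this

theorem sum_Ico_one_eq_sum_Ico_int {M : Type*} [AddCommMonoid M] (n : ℕ) (f : ℤ → M) :
    ∑ i ∈ Finset.Ico 1 n, f ((i : ℤ) - 1) = ∑ j ∈ Finset.Ico (0 : ℤ) (n - 1), f j := by
  refine Finset.sum_bij' (fun i _ => (i : ℤ) - 1) (fun j _ => (j + 1).toNat) ?_ ?_ ?_ ?_ ?_
  all_goals
    intro a ha
    rw [Finset.mem_Ico] at ha
  · rw [Finset.mem_Ico]
    omega
  · rw [Finset.mem_Ico]
    omega
  · omega
  · omega

theorem words_eq_empty {n : ℕ} (k : ℕ) {w : Equiv.Perm ℤ} (hf : FixesOutside n w)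
    (hk : k < invCount n w) : words n k w = ∅ := by
  induction k generalizing w with
  | zero =>
    rw [words, if_neg]
    rintro rfl
    rw [invCount_one] at hk
    omega
  | succ k ih =>
    rw [← Finset.card_eq_zero, card_words_succ]
    refine Finset.sum_eq_zero fun i hi => ?_
    rw [Finset.mem_Ico] at hi
    rw [Finset.card_eq_zero]
    refine ih (hf.adjSwap_mul (by omega)) ?_
    by_cases hl : LeftDescent w ((i : ℤ) - 1)
    · have := invCount_of_leftDescent hf hl
      omega
    · have := invCount_adjSwap_mul hf (by omega) (by omega) hl
      omega

theorem card_words {n : ℕ} (k : ℕ) {w : Equiv.Perm ℤ} (hf : FixesOutside n w)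
    (hk : invCount n w = k) : ((words n k w).card : ℚ) = redCount n k w := by
  induction k generalizing w with
  | zero =>
    rw [words, redCount]
    split_ifs <;> simp
  | succ k ih =>
    have hterm : ∀ i ∈ Finset.Ico 1 n,
        ((words n k (adjSwap ((i : ℤ) - 1) * w)).card : ℚ) =
          if LeftDescent w ((i : ℤ) - 1) then redCount n k (adjSwap ((i : ℤ) - 1) * w) else 0 := by
      intro i hi
      rw [Finset.mem_Ico] at hi
      have hf' : FixesOutside n (adjSwap ((i : ℤ) - 1) * w) := hf.adjSwap_mul (by omega)
      split_ifs with hl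
      · have := invCount_of_leftDescent hf hl
        exact ih hf' (by omega)
      · have := invCount_adjSwap_mul hf (by omega) (by omega) hl
        rw [words_eq_empty k hf' (by omega)]
        simp
    rw [card_words_succ, Nat.cast_sum, Finset.sum_congr rfl hterm,
      sum_Ico_one_eq_sum_Ico_int n fun j =>
        if LeftDescent w j then redCount n k (adjSwap j * w) else 0, redCount]
    refine Finset.sum_subset (Finset.Ico_subset_Ico (by omega) (by omega)) fun j _ hj => ?_
    rw [if_neg]
    intro hl
    have := hf.leftDescent_bounds hl
    rw [Finset.mem_Ico] at hj
    omega

/-- The inclusion of `{0, …, n - 1}` into `ℤ`. -/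
def finToInt (n : ℕ) : Fin n ↪ ℤ := ⟨fun i => ((i : ℕ) : ℤ), fun i j h => by
  simpa [Fin.ext_iff] using h⟩

/-- The extension of permutations of `{0, …, n - 1}` to `ℤ`. -/
noncomputable def extendPerm (n : ℕ) : Equiv.Perm (Fin n) →* Equiv.Perm ℤ :=
  Equiv.Perm.viaEmbeddingHom (finToInt n)

theorem extendPerm_apply {n : ℕ} (g : Equiv.Perm (Fin n)) (x : Fin n) :
    extendPerm n g ((x : ℕ) : ℤ) = ((g x : ℕ) : ℤ) :=
  g.viaEmbedding_apply (finToInt n) x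

theorem fixesOutside_extendPerm {n : ℕ} (g : Equiv.Perm (Fin n)) :
    FixesOutside n (extendPerm n g) := fun x hx => by
  refine g.viaEmbedding_apply_of_notMem (finToInt n) x ?_
  rintro ⟨y, rfl⟩
  have h : finToInt n y = ((y : ℕ) : ℤ) := rfl
  rw [h] at hx
  omega

theorem extendPerm_simpleRefl {n i : ℕ} (h : 1 ≤ i ∧ i < n) :
    extendPerm n (simpleRefl n i) = adjSwap ((i : ℤ) - 1) := by
  ext x
  by_cases hx : x < 0 ∨ (n : ℤ) ≤ x
  · rw [fixesOutside_extendPerm _ x hx, adjSwap_apply, if_neg (by omega), if_neg (by omega)]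
  · obtain ⟨y, rfl⟩ : ∃ y : Fin n, x = ((y : ℕ) : ℤ) := ⟨⟨x.toNat, by omega⟩, by simp; omega⟩
    rw [extendPerm_apply, simpleRefl, dif_pos h, adjSwap_apply, Equiv.swap_apply_def]
    simp only [Fin.ext_iff]
    split_ifs <;> first | omega | (simp only; omega)

theorem isWordFor_iff {n : ℕ} (g : Equiv.Perm (Fin n)) (l : List ℕ) :
    IsWordFor n g l ↔ l ∈ words n l.length (extendPerm n g) := by
  have hr : (∀ i ∈ l, 1 ≤ i ∧ i ≤ n - 1) ↔ ∀ i ∈ l, 1 ≤ i ∧ i < n :=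
    forall₂_congr fun i _ => by omega
  rw [IsWordFor, mem_words, hr]
  simp only [true_and]
  refine and_congr_right fun h => ?_
  rw [← (Equiv.Perm.viaEmbeddingHom_injective (finToInt n)).eq_iff]
  change extendPerm n _ = extendPerm n _ ↔ _
  rw [wordProd, map_list_prod, List.map_map]
  have : l.map (extendPerm n ∘ simpleRefl n) = l.map fun i : ℕ => adjSwap ((i : ℤ) - 1) :=
    List.map_congr_left fun i hi => extendPerm_simpleRefl (h i hi)
  rw [this]

theorem isReducedWordFor_iff {n k : ℕ} {g : Equiv.Perm (Fin n)}
    (hk : invCount n (extendPerm n g) = k) (hne : (words n k (extendPerm n g)).Nonempty)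
    (l : List ℕ) : IsReducedWordFor n g l ↔ l ∈ words n k (extendPerm n g) := by
  have hlen : ∀ l', IsWordFor n g l' → k ≤ l'.length := by
    intro l' hl'
    by_contra hlt
    rw [isWordFor_iff, words_eq_empty _ (fixesOutside_extendPerm g) (by omega)] at hl'
    simp at hl'
  obtain ⟨l₀, hl₀⟩ := hne
  have hl₀k := (mem_words.1 hl₀).1
  constructor
  · rintro ⟨h1, h2⟩
    have h3 := h2 l₀ ((isWordFor_iff g l₀).2 (hl₀k ▸ hl₀))
    have h4 : l.length = k := le_antisymm (by omega) (hlen l h1)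
    exact h4 ▸ (isWordFor_iff g l).1 h1
  · intro h
    have h4 := (mem_words.1 h).1
    exact ⟨(isWordFor_iff g l).2 (h4.symm ▸ h), fun l' hl' => h4.symm ▸ hlen l' hl'⟩

theorem extendPerm_longest_apply (n : ℕ) (x : ℤ) :
    extendPerm n (w₀ n) x = if 0 ≤ x ∧ x < n then n - 1 - x else x := by
  split_ifs with h
  · obtain ⟨y, rfl⟩ : ∃ y : Fin n, x = ((y : ℕ) : ℤ) := ⟨⟨x.toNat, by omega⟩, by simp; omega⟩
    rw [extendPerm_apply, w₀, Fin.revPerm_apply, Fin.val_rev]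
    omega
  · exact fixesOutside_extendPerm _ x (by omega)

theorem isDominant_longest (n : ℕ) : IsDominant n (extendPerm n (w₀ n)) := by
  intro i j m hi hij hjm hmn
  simp only [extendPerm_longest_apply]
  split_ifs <;> omega

theorem lehmer_longest (n : ℕ) {a : ℤ} (ha : 0 ≤ a) (han : a < n) :
    lehmer n (extendPerm n (w₀ n)) a = (n - 1 - a).toNat := by
  rw [lehmer, Finset.filter_true_of_mem, Int.card_Ioo]
  · congr 1
    ring
  · intro c hc
    rw [Finset.mem_Ioo] at hc
    simp only [extendPerm_longest_apply]
    split_ifs <;> omega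

theorem shiftedCode_longest (n : ℕ) :
    shiftedCode n (extendPerm n (w₀ n)) = fun i : Fin n => 2 * (i : ℕ) := by
  funext i
  have := i.2
  rw [shiftedCode, lehmer_longest n (by omega) (by omega)]
  omega

theorem two_mul_invCount_longest (n : ℕ) :
    2 * invCount n (extendPerm n (w₀ n)) = n * (n - 1) := by
  have h : invCount n (extendPerm n (w₀ n)) = ∑ i ∈ Finset.range n, i := by
    rw [invCount, sum_Ico_eq_sum_fin, ← Fin.sum_univ_eq_sum_range fun i => i]
    refine Finset.sum_congr rfl fun i _ => ?_
    have := i.2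
    rw [lehmer_longest n (by omega) (by omega)]
    omega
  rw [h, mul_comm, Finset.sum_range_id_mul_two]

section Notched

variable {n i : ℕ}

theorem swap_mul_longest_apply (hi : i + 2 < n) (x : ℤ) :
    (Equiv.swap (i : ℤ) (i + 2) * extendPerm n (w₀ n)) x =
      if x = n - 1 - i then (i + 2 : ℤ) else if x = n - 3 - i then (i : ℤ) else
        if 0 ≤ x ∧ x < n then n - 1 - x else x := by
  rw [Equiv.Perm.mul_apply, extendPerm_longest_apply, Equiv.swap_apply_def]
  split_ifs <;> omega

theorem fixesOutside_swap_mul_longest (hi : i + 2 < n) :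
    FixesOutside n (Equiv.swap (i : ℤ) (i + 2) * extendPerm n (w₀ n)) :=
  (fixesOutside_swap (by omega) (by omega) (by omega) (by omega)).mul (fixesOutside_extendPerm _)

theorem isDominant_swap_mul_longest (hi : i + 2 < n) :
    IsDominant n (Equiv.swap (i : ℤ) (i + 2) * extendPerm n (w₀ n)) := by
  intro a b c ha hab hbc hcn
  simp only [swap_mul_longest_apply hi]
  split_ifs <;> omega

theorem lehmer_swap_mul_longest (hi : i + 2 < n) {a : ℤ} (ha : 0 ≤ a) (han : a < n) :
    lehmer n (Equiv.swap (i : ℤ) (i + 2) * extendPerm n (w₀ n)) a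
      + (if a = n - 3 - i then 2 else 0) + (if a = n - 2 - i then 1 else 0)
      = lehmer n (extendPerm n (w₀ n)) a := by
  obtain ⟨d, hd⟩ : ∃ d : ℤ, d = if a = n - 3 - i ∨ a = n - 2 - i then (n - 1 - i : ℤ) else a :=
    ⟨_, rfl⟩
  have h : lehmer n (Equiv.swap (i : ℤ) (i + 2) * extendPerm n (w₀ n)) a
      = (Finset.Ioo d (n : ℤ)).card := by
    rw [lehmer]
    congr 1
    ext c
    simp only [Finset.mem_filter, Finset.mem_Ioo, swap_mul_longest_apply hi]
    split_ifs at hd ⊢ <;> omega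
  rw [h, Int.card_Ioo, lehmer_longest n ha han]
  split_ifs at hd ⊢ <;> omega

theorem shiftedCode_swap_mul_longest (hi : i + 2 < n) :
    shiftedCode n (Equiv.swap (i : ℤ) (i + 2) * extendPerm n (w₀ n)) = notchedStaircase n i := by
  funext m
  have hm := m.2
  have h := lehmer_swap_mul_longest hi (a := n - 1 - (m : ℕ)) (by omega) (by omega)
  rw [lehmer_longest n (by omega) (by omega)] at h
  rw [shiftedCode, notchedStaircase]
  split_ifs at h ⊢ <;> omega

theorem invCount_swap_mul_longest (hi : i + 2 < n) :
    invCount n (Equiv.swap (i : ℤ) (i + 2) * extendPerm n (w₀ n)) + 3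
      = invCount n (extendPerm n (w₀ n)) := by
  have h : ∀ a ∈ Finset.Ico (0 : ℤ) n, _ := fun a ha =>
    lehmer_swap_mul_longest hi (Finset.mem_Ico.1 ha).1 (Finset.mem_Ico.1 ha).2
  have hs := Finset.sum_congr rfl h
  simp only [Finset.sum_add_distrib, Finset.sum_ite_eq', Finset.mem_Ico] at hs
  rw [if_pos (by omega), if_pos (by omega)] at hs
  exact hs

theorem card_words_swap_mul_longest (hi : i + 2 < n) {k : ℕ}
    (hk : invCount n (extendPerm n (w₀ n)) = k + 3) :
    ((words n k (Equiv.swap (i : ℤ) (i + 2) * extendPerm n (w₀ n))).card : ℚ)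
      = k.factorial * frobeniusDet (notchedStaircase n i) := by
  have hinv := invCount_swap_mul_longest hi
  have hf := fixesOutside_swap_mul_longest hi
  rw [card_words k hf (by omega), redCount_eq_frobeniusDet k hf
    (isDominant_swap_mul_longest hi) (by omega), shiftedCode_swap_mul_longest hi]

end Notched

theorem card_words_longest {n k : ℕ} (hk : invCount n (extendPerm n (w₀ n)) = k) :
    ((words n k (extendPerm n (w₀ n))).card : ℚ)
      = k.factorial * frobeniusDet fun i : Fin n => 2 * (i : ℕ) := by
  rw [card_words k (fixesOutside_extendPerm _) hk, redCount_eq_frobeniusDet k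
    (fixesOutside_extendPerm _) (isDominant_longest n) hk, shiftedCode_longest]

/-- The position `k` of the word `l` supports a long braid move. -/
def BraidAt (k : ℕ) (l : List ℕ) : Prop :=
  ∃ i : ℕ, (l.getD k 0, l.getD (k + 1) 0, l.getD (k + 2) 0) = (i, i + 1, i) ∨
    (l.getD k 0, l.getD (k + 1) 0, l.getD (k + 2) 0) = (i + 1, i, i + 1)

theorem braidAt_zero_cons (a b c : ℕ) (t : List ℕ) :
    BraidAt 0 (a :: b :: c :: t) ↔ c = a ∧ (b = a + 1 ∨ a = b + 1) := by
  simp only [BraidAt, List.getD_cons_zero, List.getD_cons_succ, Prod.mk.injEq]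
  constructor
  · rintro ⟨i, h | h⟩ <;> omega
  · rintro ⟨rfl, h | h⟩
    · exact ⟨c, by omega⟩
    · exact ⟨b, by omega⟩

theorem adjSwap_braid (j : ℤ) :
    adjSwap j * (adjSwap (j + 1) * adjSwap j) = Equiv.swap j (j + 2) := by
  ext x
  simp only [Equiv.Perm.mul_apply, adjSwap_apply, Equiv.swap_apply_def]
  split_ifs <;> omega

theorem adjSwap_succ_braid (j : ℤ) :
    adjSwap (j + 1) * (adjSwap j * adjSwap (j + 1)) = Equiv.swap j (j + 2) := by
  ext x
  simp only [Equiv.Perm.mul_apply, adjSwap_apply, Equiv.swap_apply_def]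
  split_ifs <;> omega

theorem card_filter_braidAt_zero (n k : ℕ) (w : Equiv.Perm ℤ) :
    ((words n (k + 3) w).filter (BraidAt 0)).card =
      2 * ∑ i ∈ Finset.range (n - 2), (words n k (Equiv.swap (i : ℤ) (i + 2) * w)).card := by
  obtain ⟨F, hF⟩ : ∃ F : ℕ → ℕ, F = fun i : ℕ =>
    (words n k (Equiv.swap ((i : ℤ) - 1) ((i : ℤ) - 1 + 2) * w)).card := ⟨_, rfl⟩
  have h1 : ∀ a ∈ Finset.Ico 1 n, ∀ b ∈ Finset.Ico 1 n, ∑ c ∈ Finset.Ico 1 n,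
      ((words n k (adjSwap ((c : ℤ) - 1) * (adjSwap ((b : ℤ) - 1) *
        (adjSwap ((a : ℤ) - 1) * w)))).filter fun t => BraidAt 0 (a :: b :: c :: t)).card
      = (if b = a + 1 then F a else 0) + (if a = b + 1 then F b else 0) := by
    intro a ha b _
    simp only [braidAt_zero_cons]
    rw [Finset.sum_eq_single_of_mem a ha]
    · simp only [true_and]
      by_cases h : b = a + 1
      · subst h
        have hb := adjSwap_braid ((a : ℤ) - 1)
        rw [sub_add_cancel] at hb
        simp only [true_or, Finset.filter_true, if_true, Nat.cast_add, Nat.cast_one,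
          add_sub_cancel_right, ← mul_assoc] at hb ⊢
        rw [hb, if_neg (by omega), add_zero, hF]
      · by_cases h' : a = b + 1
        · subst h'
          have hb := adjSwap_succ_braid ((b : ℤ) - 1)
          rw [sub_add_cancel] at hb
          simp only [or_true, Finset.filter_true, if_true, Nat.cast_add, Nat.cast_one,
            add_sub_cancel_right, ← mul_assoc] at hb ⊢
          rw [hb, if_neg (by omega), zero_add, hF]
        · simp [h, h']
    · intro c _ hc
      simp [hc]
  have h2 : ∀ a, (∑ b ∈ Finset.Ico 1 n, if b = a + 1 then F a else 0)
      = if a ∈ Finset.range (n - 1) then F a else 0 := by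
    intro a
    rw [Finset.sum_ite_eq']
    simp only [Finset.mem_Ico, Finset.mem_range]
    split_ifs <;> first | rfl | omega
  have h3 : ∀ b, (∑ a ∈ Finset.Ico 1 n, if a = b + 1 then F b else 0)
      = if b ∈ Finset.range (n - 1) then F b else 0 := h2
  have h4 : ∑ a ∈ Finset.Ico 1 n, (if a ∈ Finset.range (n - 1) then F a else 0)
      = ∑ i ∈ Finset.range (n - 2), (words n k (Equiv.swap (i : ℤ) (i + 2) * w)).card := by
    rw [← Finset.sum_filter, Finset.sum_bij' (fun a _ => a - 1) (fun i _ => i + 1)]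
    · intro a ha
      simp only [Finset.mem_filter, Finset.mem_Ico, Finset.mem_range] at ha ⊢
      omega
    · intro a ha
      simp only [Finset.mem_filter, Finset.mem_Ico, Finset.mem_range] at ha ⊢
      omega
    · intro a ha
      simp only [Finset.mem_filter, Finset.mem_Ico, Finset.mem_range] at ha ⊢
      omega
    · simp
    · intro a ha
      simp only [Finset.mem_filter, Finset.mem_Ico, Finset.mem_range] at ha ⊢
      rw [hF, Nat.cast_sub ha.1.1, Nat.cast_one]
  rw [card_filter_words_succ]
  simp only [card_filter_words_succ n (k + 1), card_filter_words_succ n k]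
  rw [Finset.sum_congr rfl fun a ha => Finset.sum_congr rfl (h1 a ha)]
  simp only [Finset.sum_add_distrib]
  rw [Finset.sum_comm (f := fun a b => if a = b + 1 then F b else 0)]
  simp only [h2, h4]
  ring

/-- Moving the first letter of a word for the longest element to the end. -/
def rotateWord (n : ℕ) (l : List ℕ) : List ℕ := l.tail ++ [n - l.headD 0]

theorem adjSwap_mul_longest (n : ℕ) {i : ℕ} (h : 1 ≤ i ∧ i < n) :
    adjSwap ((i : ℤ) - 1) * extendPerm n (w₀ n) * adjSwap (((n - i : ℕ) : ℤ) - 1)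
      = extendPerm n (w₀ n) := by
  ext x
  simp only [Equiv.Perm.mul_apply, adjSwap_apply, extendPerm_longest_apply]
  split_ifs <;> omega

theorem rotateWord_mem {n k : ℕ} {l : List ℕ} (hl : l ∈ words n (k + 1) (extendPerm n (w₀ n))) :
    rotateWord n l ∈ words n (k + 1) (extendPerm n (w₀ n)) := by
  rw [mem_words] at hl ⊢
  obtain ⟨h1, h2, h3⟩ := hl
  cases l with
  | nil => simp at h1
  | cons i t =>
    have hi := h2 i (by simp)
    have h4 : (t.map fun i : ℕ => adjSwap ((i : ℤ) - 1)).prod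
        = adjSwap ((i : ℤ) - 1) * extendPerm n (w₀ n) := by
      rw [← h3, List.map_cons, List.prod_cons, adjSwap_mul_cancel_left]
    refine ⟨by simpa [rotateWord] using h1, ?_, ?_⟩
    · intro j hj
      simp only [rotateWord, List.tail_cons, List.headD_cons, List.mem_append,
        List.mem_singleton] at hj
      rcases hj with hj | hj
      · exact h2 j (by simp [hj])
      · omega
    · rw [rotateWord, List.tail_cons, List.headD_cons, List.map_append, List.prod_append, h4,
        List.map_singleton, List.prod_singleton, adjSwap_mul_longest n hi]

theorem rotateWord_injOn (n k : ℕ) :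
    Set.InjOn (rotateWord n) (words n (k + 1) (extendPerm n (w₀ n)) : Set (List ℕ)) := by
  intro l hl l' hl' h
  rw [Finset.mem_coe, mem_words] at hl hl'
  obtain ⟨h1, h2, -⟩ := hl
  obtain ⟨h1', h2', -⟩ := hl'
  cases l with
  | nil => simp at h1
  | cons i t =>
    cases l' with
    | nil => simp at h1'
    | cons i' t' =>
      have hi := h2 i (by simp)
      have hi' := h2' i' (by simp)
      simp only [rotateWord, List.tail_cons, List.headD_cons] at h
      obtain ⟨ht, hn⟩ := List.append_inj' h rfl
      simp only [List.cons.injEq, and_true] at hn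
      rw [ht, show i = i' by omega]

theorem braidAt_rotateWord {n k : ℕ} {l : List ℕ} (hl : k + 3 < l.length) :
    BraidAt k (rotateWord n l) ↔ BraidAt (k + 1) l := by
  cases l with
  | nil => simp at hl
  | cons i t =>
    rw [List.length_cons] at hl
    simp only [BraidAt, rotateWord, List.tail_cons, List.headD_cons, List.getD_cons_succ]
    rw [List.getD_append _ _ _ _ (by omega), List.getD_append _ _ _ _ (by omega),
      List.getD_append _ _ _ _ (by omega)]

theorem card_filter_braidAt {n k : ℕ} (j : ℕ) (hj : j ≤ k) :
    ((words n (k + 3) (extendPerm n (w₀ n))).filter (BraidAt j)).card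
      = ((words n (k + 3) (extendPerm n (w₀ n))).filter (BraidAt 0)).card := by
  induction j with
  | zero => rfl
  | succ j ih =>
    rw [← ih (by omega)]
    have hinj := rotateWord_injOn n (k + 2)
    have himage : (words n (k + 3) (extendPerm n (w₀ n))).image (rotateWord n)
        = words n (k + 3) (extendPerm n (w₀ n)) := by
      refine Finset.eq_of_subset_of_card_le ?_ (Finset.card_image_of_injOn hinj).ge
      exact Finset.image_subset_iff.2 fun l hl => rotateWord_mem hl
    conv_rhs => rw [← himage]
    rw [Finset.filter_image, Finset.card_image_of_injOn (hinj.mono fun l hl => by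
      simp only [Finset.coe_filter, Set.mem_ofPred_eq] at hl
      exact hl.1)]
    congr 1
    refine Finset.filter_congr fun l hl => ?_
    rw [braidAt_rotateWord (by rw [(mem_words.1 hl).1]; omega)]

theorem sum_braidCount {n k : ℕ} (hn : 3 ≤ n)
    (hk : invCount n (extendPerm n (w₀ n)) = k + 3) :
    (∑ l ∈ words n (k + 3) (extendPerm n (w₀ n)), (braidCount l : ℚ))
      = (words n (k + 3) (extendPerm n (w₀ n))).card := by
  have h1 : ∀ l ∈ words n (k + 3) (extendPerm n (w₀ n)), braidCount l
      = ∑ j ∈ Finset.range (k + 1), if BraidAt j l then 1 else 0 := by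
    intro l hl
    rw [braidCount, (mem_words.1 hl).1, Finset.card_filter]
    rfl
  rw [← Nat.cast_sum, Finset.sum_congr rfl h1, Finset.sum_comm]
  simp only [← Finset.card_filter]
  rw [Finset.sum_congr rfl fun j hj =>
    card_filter_braidAt j (Nat.lt_succ_iff.1 (Finset.mem_range.1 hj)),
    Finset.sum_const, Finset.card_range, card_filter_braidAt_zero, smul_eq_mul]
  push_cast
  rw [Finset.sum_congr rfl fun i hi => card_words_swap_mul_longest
    (by rw [Finset.mem_range] at hi; omega) hk, ← Finset.mul_sum, card_words_longest hk]
  obtain ⟨N, rfl⟩ : ∃ N, n = N + 3 := ⟨n - 3, by omega⟩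
  have h2 := sum_frobeniusDet_notchedStaircase N
  rw [show N + 3 - 2 = N + 1 by omega, h2]
  have h3 := two_mul_invCount_longest (N + 3)
  rw [hk, show N + 3 - 1 = N + 2 by omega] at h3
  have h4 : (2 * (k + 3) : ℚ) = (N + 3) * (N + 2) := by exact_mod_cast h3
  have h5 : (2 * (k + 2) : ℚ) = (N + 1) * (N + 4) := by linear_combination h4
  have h6 : ((N + 1) * (N + 2) * (N + 3) * (N + 4) / 8 : ℚ) = (k + 3) * (k + 2) / 2 := by
    linear_combination (-(N + 1 : ℚ) * (N + 4) / 8) * h4 - ((k : ℚ) + 3) / 4 * h5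
  rw [h6, Nat.factorial_succ, Nat.factorial_succ, Nat.factorial_succ]
  push_cast
  ring

/-- The expected number of long braid moves in a random reduced word of `w₀` is one. -/
theorem expectedStat_braidCount {n : ℕ} (hn : 3 ≤ n) : expectedStat n braidCount = 1 := by
  obtain ⟨k, hk⟩ : ∃ k, invCount n (extendPerm n (w₀ n)) = k + 3 := by
    have h := two_mul_invCount_longest n
    have : 3 * 2 ≤ n * (n - 1) := Nat.mul_le_mul hn (by omega)
    exact ⟨invCount n (extendPerm n (w₀ n)) - 3, by omega⟩
  have hcard : ((words n (k + 3) (extendPerm n (w₀ n))).card : ℚ) ≠ 0 := by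
    rw [card_words_longest hk]
    exact mul_ne_zero (Nat.cast_ne_zero.2 (Nat.factorial_ne_zero _))
      (frobeniusDet_two_mul_ne_zero n)
  have hne : (words n (k + 3) (extendPerm n (w₀ n))).Nonempty := by
    rw [← Finset.card_ne_zero]
    exact_mod_cast hcard
  have hset : {l : List ℕ | IsReducedWordFor n (w₀ n) l}
      = (words n (k + 3) (extendPerm n (w₀ n)) : Set (List ℕ)) := by
    ext l
    exact isReducedWordFor_iff hk hne l
  have hnat : Nat.card {l : List ℕ // IsReducedWordFor n (w₀ n) l}
      = (words n (k + 3) (extendPerm n (w₀ n))).card := by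
    change Nat.card {l : List ℕ | IsReducedWordFor n (w₀ n) l} = _
    rw [hset, Nat.card_coe_set_eq, Set.ncard_coe_finset]
  rw [expectedStat, hnat, hset, finsum_mem_coe_finset]
  have hsum : (∑ l ∈ words n (k + 3) (extendPerm n (w₀ n)), (braidCount l : ℝ))
      = (words n (k + 3) (extendPerm n (w₀ n))).card := by
    exact_mod_cast sum_braidCount hn hk
  rw [hsum, div_self]
  exact_mod_cast hcard

/-- The asymptotic frequency of long braid moves in a uniformly random reduced word for
`w₀ ∈ S_n` is `2/n²`. -/
theorem long_braid_frequency :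
    Filter.Tendsto
      (fun n : ℕ => (n : ℝ) ^ 2 * expectedStat n braidCount / ((n : ℝ) * ((n : ℝ) - 1) / 2))
      Filter.atTop (nhds 2) := by
  have h : Filter.Tendsto (fun n : ℕ => 2 / (1 - 1 / (n : ℝ))) Filter.atTop (nhds (2 / (1 - 0))) :=
    tendsto_const_nhds.div (tendsto_const_nhds.sub tendsto_one_div_atTop_nhds_zero_nat) (by simp)
  rw [sub_zero, div_one] at h
  refine h.congr' ?_
  filter_upwards [Filter.eventually_ge_atTop 3] with n hn
  have h3 : (3 : ℝ) ≤ n := by exact_mod_cast hn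
  have h0 : (n : ℝ) ≠ 0 := by linarith
  have h1 : (n : ℝ) - 1 ≠ 0 := by linarith
  rw [expectedStat_braidCount hn]
  field_simp
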